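/- arXiv:2503.03551 — 3 statements merged into one kernel-verified Lean document; each statement's English description precedes it below -/
import Mathlib

section
/- Let A, B be finite algebras in a locally finite Taylor variety, and let ρ ∈ Con(A), σ ∈ Con(B) be meet-irreducible with unique upper covers ρ⁺, σ⁺ respectively. If there exists a good bridge from (A,ρ) to (B,σ), then ρ⁺/ρ is abelian if and only if σ⁺/σ is abelian. -/
namespace Zhuk

/-- A signature: a type of operation symbols with arities. -/
structure Signature where
  ops : Type
  arity : ops → ℕ

/-- An algebra structure of signature `S` on carrier `A`. -/
class SAlg (S : Signature) (A : Type) where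
  interp : (o : S.ops) → (Fin (S.arity o) → A) → A

variable {S : Signature}

/-- Componentwise algebra structure on a product. -/
instance prodSAlg {A B : Type} [SAlg S A] [SAlg S B] : SAlg S (A × B) :=
  ⟨fun o x => (SAlg.interp o fun i => (x i).1, SAlg.interp o fun i => (x i).2)⟩

/-- A subset closed under all the operations. -/
def IsSubuniverse (S : Signature) {A : Type} [SAlg S A] (R : Set A) : Prop :=
  ∀ (o : S.ops) (x : Fin (S.arity o) → A), (∀ i, x i ∈ R) → SAlg.interp o x ∈ R

/-- The algebra structure on (the subtype of) a subuniverse. -/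
def subAlg {A : Type} [SAlg S A] (R : Set A) (h : IsSubuniverse S R) : SAlg S ↥R :=
  ⟨fun o x => ⟨SAlg.interp o fun i => (x i).1, h o _ fun i => (x i).2⟩⟩

/-- Terms of signature `S` in `n` variables. -/
inductive STerm (S : Signature) (n : ℕ) : Type
  | var : Fin n → STerm S n
  | app (o : S.ops) : (Fin (S.arity o) → STerm S n) → STerm S n

/-- Evaluation of a term in an algebra. -/
def STerm.eval {A : Type} [SAlg S A] {n : ℕ} : STerm S n → (Fin n → A) → A
  | .var i, v => v i
  | .app o ts, v => SAlg.interp o fun i => (ts i).eval v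

/-- The diagonal (smallest) congruence `0_A`. -/
def diag (A : Type) : Set (A × A) := {p | p.1 = p.2}

/-- Relational composition. -/
def rcomp {A B C : Type} (R : Set (A × B)) (T : Set (B × C)) : Set (A × C) :=
  {p | ∃ b, (p.1, b) ∈ R ∧ (b, p.2) ∈ T}

/-- Relational inverse. -/
def rinv {A B : Type} (R : Set (A × B)) : Set (B × A) := {p | (p.2, p.1) ∈ R}

/-- Transitive closure of a binary relation (as a set of pairs). -/
def transCl {A : Type} (R : Set (A × A)) : Set (A × A) :=
  {p | Relation.TransGen (fun a b => (a, b) ∈ R) p.1 p.2}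

/-- `R` is stable under (saturated with respect to) `ρ`:  `R = ρ ∘ R ∘ ρ`. -/
def Saturated {A : Type} (ρ R : Set (A × A)) : Prop := rcomp ρ (rcomp R ρ) = R

/-- A congruence: a subuniverse of `A²` which is an equivalence relation. -/
def IsCongruence (S : Signature) {A : Type} [SAlg S A] (θ : Set (A × A)) : Prop :=
  IsSubuniverse S θ ∧ Equivalence fun a b => (a, b) ∈ θ

/-- `ρ ∈ Con*(A)`: a congruence different from the full congruence `1_A`. -/
def ConStar (S : Signature) {A : Type} [SAlg S A] (ρ : Set (A × A)) : Prop :=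
  IsCongruence S ρ ∧ ρ ≠ Set.univ

/-- The ternary centralizer relation `C(φ, θ; δ)`, via the term condition. -/
def Centralizes (S : Signature) {A : Type} [SAlg S A] (φ θ δ : Set (A × A)) : Prop :=
  ∀ (n : ℕ) (t : STerm S (n + 1)) (a b : A) (c d : Fin n → A),
    (a, b) ∈ φ → (∀ i, (c i, d i) ∈ θ) →
    (t.eval (Fin.cons a c), t.eval (Fin.cons a d)) ∈ δ →
    (t.eval (Fin.cons b c), t.eval (Fin.cons b d)) ∈ δ

/-- The centralizer `(δ : θ)`: the largest congruence `φ` with `C(φ, θ; δ)`. -/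
def centralizer (S : Signature) {A : Type} [SAlg S A] (δ θ : Set (A × A)) : Set (A × A) :=
  ⋃₀ {φ | IsCongruence S φ ∧ Centralizes S φ θ δ}

/-- A congruence of the subalgebra `A(θ) ≤ A²`, viewed ambiently as a subset of
`(A×A) × (A×A)` whose field is `θ`. -/
def IsConOn (S : Signature) {A : Type} [SAlg S A] (θ : Set (A × A))
    (Δ : Set ((A × A) × (A × A))) : Prop :=
  Δ ⊆ θ ×ˢ θ ∧ IsSubuniverse S Δ ∧ (∀ p ∈ θ, (p, p) ∈ Δ) ∧
    (∀ p q, (p, q) ∈ Δ → (q, p) ∈ Δ) ∧ (∀ p q r, (p, q) ∈ Δ → (q, r) ∈ Δ → (p, r) ∈ Δ)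

/-- `Δ_{θ,α}`: the congruence of `A(θ)` generated by `{((a,a),(b,b)) : (a,b) ∈ α}`. -/
def DeltaCon (S : Signature) {A : Type} [SAlg S A] (θ α : Set (A × A)) :
    Set ((A × A) × (A × A)) :=
  ⋂₀ {Δ | IsConOn S θ Δ ∧ ∀ a b : A, (a, b) ∈ α → ((a, a), (b, b)) ∈ Δ}

/-- Projection of a quaternary relation to its first two coordinates. -/
def pr12 {A B : Type} (T : Set (A × A × B × B)) : Set (A × A) :=
  {p | ∃ b₁ b₂, (p.1, p.2, b₁, b₂) ∈ T}

/-- Projection of a quaternary relation to its last two coordinates. -/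
def pr34 {A B : Type} (T : Set (A × A × B × B)) : Set (B × B) :=
  {q | ∃ a₁ a₂, (a₁, a₂, q.1, q.2) ∈ T}

/-- The trace of a quaternary relation. -/
def btr {A B : Type} (T : Set (A × A × B × B)) : Set (A × B) :=
  {p | (p.1, p.1, p.2, p.2) ∈ T}

/-- Zhuk's bridges: Definition 4.3 (B0*), (B1*), (B2*). -/
def IsBridge (S : Signature) {A B : Type} [SAlg S A] [SAlg S B]
    (ρ : Set (A × A)) (σ : Set (B × B)) (T : Set (A × A × B × B)) : Prop :=
  IsSubuniverse S T ∧
  (∀ a₁ a₂ b₁ b₂ a₁' a₂', (a₁, a₂, b₁, b₂) ∈ T → (a₁, a₁') ∈ ρ → (a₂, a₂') ∈ ρ →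
    (a₁', a₂', b₁, b₂) ∈ T) ∧
  (∀ a₁ a₂ b₁ b₂ b₁' b₂', (a₁, a₂, b₁, b₂) ∈ T → (b₁, b₁') ∈ σ → (b₂, b₂') ∈ σ →
    (a₁, a₂, b₁', b₂') ∈ T) ∧
  ρ ⊂ pr12 T ∧ σ ⊂ pr34 T ∧
  (∀ a₁ a₂ b₁ b₂, (a₁, a₂, b₁, b₂) ∈ T → ((a₁, a₂) ∈ ρ ↔ (b₁, b₂) ∈ σ))

/-- A bridge from `(A,ρ,L)` to `(B,σ,R)`: a bridge with prescribed anchors. -/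
def IsBridgeLR (S : Signature) {A B : Type} [SAlg S A] [SAlg S B]
    (ρ : Set (A × A)) (σ : Set (B × B)) (L : Set (A × A)) (R : Set (B × B))
    (T : Set (A × A × B × B)) : Prop :=
  IsBridge S ρ σ T ∧ pr12 T = L ∧ pr34 T = R

/-- A reflexive bridge (case `B = A`): `0_A ⊆ tr(T)`. -/
def ReflBridge {A : Type} (T : Set (A × A × A × A)) : Prop :=
  ∀ a : A, (a, a) ∈ btr T

/-- `Cov(ρ)`: the inclusion-minimal ρ-saturated subuniverses of `A²` properly containing ρ. -/
def Cov (S : Signature) {A : Type} [SAlg S A] (ρ : Set (A × A)) : Set (Set (A × A)) :=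
  {L | IsSubuniverse S L ∧ Saturated ρ L ∧ ρ ⊂ L ∧
    ∀ L', IsSubuniverse S L' → Saturated ρ L' → ρ ⊂ L' → L' ⊆ L → L' = L}

/-- `ref.tr(ρ,L)`: traces of reflexive bridges from `(A,ρ,L)` to itself. -/
def refTr (S : Signature) {A : Type} [SAlg S A] (ρ L : Set (A × A)) : Set (Set (A × A)) :=
  {γ | ∃ T : Set (A × A × A × A), IsBridgeLR S ρ ρ L L T ∧ ReflBridge T ∧ btr T = γ}

/-- `γ = Opt(ρ,L)`: `γ` is the (unique) inclusion-maximal member of `ref.tr(ρ,L)`. -/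
def IsOptOf (S : Signature) {A : Type} [SAlg S A] (ρ L γ : Set (A × A)) : Prop :=
  γ ∈ refTr S ρ L ∧ ∀ δ ∈ refTr S ρ L, γ ⊆ δ → δ = γ

/-- `ρ` is meet-irreducible with unique upper cover `ρplus`. -/
def MeetIrredWith (S : Signature) {A : Type} [SAlg S A] (ρ ρplus : Set (A × A)) : Prop :=
  IsCongruence S ρ ∧ ρ ≠ Set.univ ∧ IsCongruence S ρplus ∧ ρ ⊂ ρplus ∧
    ∀ θ, IsCongruence S θ → ρ ⊂ θ → ρplus ⊆ θ

/-- `Cov⁺(ρ) = {τ ∈ Cov(ρ) : τ ⊆ ρ⁺}`. -/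
def CovPlus (S : Signature) {A : Type} [SAlg S A] (ρ ρplus : Set (A × A)) :
    Set (Set (A × A)) :=
  {τ | τ ∈ Cov S ρ ∧ τ ⊆ ρplus}

/-- A good bridge between meet-irreducible congruences with upper covers `ρplus`, `σplus`. -/
def GoodBridge (S : Signature) {A B : Type} [SAlg S A] [SAlg S B]
    (ρ ρplus : Set (A × A)) (σ σplus : Set (B × B)) (T : Set (A × A × B × B)) : Prop :=
  IsBridge S ρ σ T ∧
    ∃ τ ∈ CovPlus S ρ ρplus, ∃ τ' ∈ CovPlus S σ σplus, ∃ T' ⊆ T,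
      IsBridgeLR S ρ σ τ τ' T' ∧ btr T' = btr T

/-- `t` (with Taylor-identity data `u v`) is idempotent on `A` and satisfies the
corresponding identities on `A`. -/
def TaylorOn (S : Signature) (A : Type) [SAlg S A] {n : ℕ} (t : STerm S n)
    (u v : Fin n → Fin n → Fin 2) : Prop :=
  (∀ a : A, t.eval (fun _ => a) = a) ∧
    ∀ (i : Fin n) (x y : A),
      t.eval (fun j => if u i j = 0 then x else y) =
        t.eval (fun j => if v i j = 0 then x else y)

/-- `A` is a Taylor algebra. -/
def IsTaylorAlg (S : Signature) (A : Type) [SAlg S A] : Prop :=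
  ∃ (n : ℕ) (t : STerm S n) (u v : Fin n → Fin n → Fin 2),
    1 < n ∧ (∀ i, u i i ≠ v i i) ∧ TaylorOn S A t u v

/-- `A` and `B` lie in a common (locally finite, as they are finite) Taylor variety:
they share a common Taylor term with common Taylor identities. -/
def CommonTaylor (S : Signature) (A B : Type) [SAlg S A] [SAlg S B] : Prop :=
  ∃ (n : ℕ) (t : STerm S n) (u v : Fin n → Fin n → Fin 2),
    1 < n ∧ (∀ i, u i i ≠ v i i) ∧ TaylorOn S A t u v ∧ TaylorOn S B t u v

/-- The quotient of `A` by (the equivalence relation of) `θ`. -/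
abbrev ConQuot {A : Type} (θ : Set (A × A)) : Type :=
  Quot (fun a b => (a, b) ∈ θ)

/-- The class of `a` in `A/θ`. -/
def ConQuot.mk {A : Type} (θ : Set (A × A)) (a : A) : ConQuot θ :=
  Quot.mk _ a

/-- The quotient algebra structure on `A/θ` (extensionally correct when `θ` is a
congruence). -/
noncomputable def quotAlg {S : Signature} {A : Type} (iA : SAlg S A) (θ : Set (A × A)) :
    SAlg S (ConQuot θ) :=
  ⟨fun o x => ConQuot.mk θ
    (@SAlg.interp S A iA o fun i => Classical.choose (Quot.exists_rep (x i)))⟩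

/-- `f` is a homomorphism with respect to the given algebra structures. -/
def IsHomI {S : Signature} {A B : Type} (iA : SAlg S A) (iB : SAlg S B) (f : A → B) : Prop :=
  ∀ (o : S.ops) (x : Fin (S.arity o) → A),
    f (@SAlg.interp S A iA o x) = @SAlg.interp S B iB o fun i => f (x i)

/-- The two algebras are isomorphic. -/
def IsoAlgI {S : Signature} {A B : Type} (iA : SAlg S A) (iB : SAlg S B) : Prop :=
  ∃ f : A ≃ B, IsHomI iA iB f

/-- The identity bridge `I_{(A,ρ,L)}`. -/
def idBridge {A : Type} (ρ L : Set (A × A)) : Set (A × A × A × A) :=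
  {p | (p.1, p.2.1) ∈ L ∧ (p.2.2.1, p.2.2.2) ∈ L ∧ (p.1, p.2.2.1) ∈ ρ ∧ (p.2.1, p.2.2.2) ∈ ρ}

/-- Composition of quaternary relations (bridges). -/
def bComp {A B C : Type} (T : Set (A × A × B × B)) (T' : Set (B × B × C × C)) :
    Set (A × A × C × C) :=
  {p | ∃ b₁ b₂, (p.1, p.2.1, b₁, b₂) ∈ T ∧ (b₁, b₂, p.2.2.1, p.2.2.2) ∈ T'}

/-- Converse of a quaternary relation (bridge). -/
def bConv {A B : Type} (T : Set (A × A × B × B)) : Set (B × B × A × A) :=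
  {p | (p.2.2.1, p.2.2.2, p.1, p.2.1) ∈ T}

/-- `Δ♭_{θ,α}`: the congruence `Δ_{θ,α}` of `A(θ)` viewed as a quaternary relation. -/
def deltaFlat (S : Signature) {A : Type} [SAlg S A] (θ α : Set (A × A)) :
    Set (A × A × A × A) :=
  {p | ((p.1, p.2.1), (p.2.2.1, p.2.2.2)) ∈ DeltaCon S θ α}

/-- `T^opt_{(A,ρ)} = I_{(A,ρ,ρ⁺)} ∘ Δ♭_{ρ⁺,(ρ:ρ⁺)} ∘ I_{(A,ρ,ρ⁺)}`. -/
def Topt (S : Signature) {A : Type} [SAlg S A] (ρ ρplus : Set (A × A)) :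
    Set (A × A × A × A) :=
  bComp (idBridge ρ ρplus)
    (bComp (deltaFlat S ρplus (centralizer S ρ ρplus)) (idBridge ρ ρplus))

/-- `A` is subdirectly irreducible with monolith `μ`. -/
def IsMonolith (S : Signature) {A : Type} [SAlg S A] (μ : Set (A × A)) : Prop :=
  IsCongruence S μ ∧ μ ≠ diag A ∧ ∀ θ, IsCongruence S θ → θ ≠ diag A → μ ⊆ θ

/-- The carrier of `D(A,θ)`-style quotients: `A(μ)/Δ_{μ,α}`. -/
abbrev DCar (S : Signature) (A : Type) [SAlg S A] (μ α : Set (A × A)) : Type :=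
  Quot (fun p q : ↥μ => ((p : A × A), (q : A × A)) ∈ DeltaCon S μ α)

/-- The class of a pair `p ∈ μ` in `A(μ)/Δ_{μ,α}`. -/
def DCar.mk (S : Signature) (A : Type) [SAlg S A] (μ α : Set (A × A)) (p : ↥μ) :
    DCar S A μ α :=
  Quot.mk _ p

/-- The algebra structure on `A(μ)/Δ_{μ,α}` (extensionally correct when `μ` is a
congruence and `Δ_{μ,α}` is a congruence of `A(μ)`). -/
noncomputable def DAlg (S : Signature) (A : Type) [SAlg S A] (μ α : Set (A × A))
    (h : IsSubuniverse S μ) : SAlg S (DCar S A μ α) :=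
  letI := subAlg μ h
  ⟨fun o x => DCar.mk S A μ α
    (SAlg.interp o fun i => Classical.choose (Quot.exists_rep (x i)))⟩

/-- The canonical similarity bridge `T_{D(A)}` from `A` to `D(A)`. -/
def TDBridge (S : Signature) (A : Type) [SAlg S A] (μ α : Set (A × A)) :
    Set (A × A × DCar S A μ α × DCar S A μ α) :=
  {x | ∃ (a b e : A) (_ : (a, b) ∈ μ) (h1 : (a, e) ∈ μ) (h2 : (b, e) ∈ μ),
    x = (a, b, DCar.mk S A μ α ⟨(a, e), h1⟩, DCar.mk S A μ α ⟨(b, e), h2⟩)}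

/-- Similarity of (subdirectly irreducible) algebras: `D(A) ≅ D(B)`, where `D(X)` is
`X(μ)/Δ_{μ,(0:μ)}` if the monolith `μ` is abelian, and `X` itself otherwise. -/
def SimilarI (S : Signature) {A B : Type} (iA : SAlg S A) (iB : SAlg S B) : Prop :=
  letI := iA
  letI := iB
  ∃ (μA : Set (A × A)) (μB : Set (B × B)) (hA : IsMonolith S μA) (hB : IsMonolith S μB),
    ((Centralizes S μA μA (diag A) ∧ Centralizes S μB μB (diag B)) →
      IsoAlgI (DAlg S A μA (centralizer S (diag A) μA) hA.1.1)
        (DAlg S B μB (centralizer S (diag B) μB) hB.1.1)) ∧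
    ((Centralizes S μA μA (diag A) ∧ ¬ Centralizes S μB μB (diag B)) →
      IsoAlgI (DAlg S A μA (centralizer S (diag A) μA) hA.1.1) iB) ∧
    ((¬ Centralizes S μA μA (diag A) ∧ Centralizes S μB μB (diag B)) →
      IsoAlgI iA (DAlg S B μB (centralizer S (diag B) μB) hB.1.1)) ∧
    ((¬ Centralizes S μA μA (diag A) ∧ ¬ Centralizes S μB μB (diag B)) →
      IsoAlgI iA iB)

end Zhuk

namespace Zhuk

section Polynomials

variable {S : Signature} {A B X Y : Type}

/-- Polynomial operations of an algebra, with variables indexed by `X`. -/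
inductive IsPoly (S : Signature) {A : Type} [SAlg S A] {X : Type} : ((X → A) → A) → Prop
  | proj (i : X) : IsPoly S fun x => x i
  | const (a : A) : IsPoly S fun _ => a
  | app (o : S.ops) (f : Fin (S.arity o) → (X → A) → A) (h : ∀ i, IsPoly S (f i)) :
      IsPoly S fun x => SAlg.interp o fun i => f i x

variable [SAlg S A] [SAlg S B]

theorem IsPoly.comp {f : (X → A) → A} (hf : IsPoly S f) {g : (Y → A) → X → A}
    (hg : ∀ i, IsPoly S fun e => g e i) : IsPoly S fun e => f (g e) := by
  induction hf with
  | proj i => exact hg i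
  | const a => exact .const a
  | app o f _ ih => exact .app o (fun i e => f i (g e)) ih

theorem STerm.isPoly_eval {n : ℕ} (t : STerm S n) {g : (X → A) → Fin n → A}
    (hg : ∀ i, IsPoly S fun e => g e i) : IsPoly S fun e => t.eval (g e) := by
  induction t with
  | var i => exact hg i
  | app o ts ih => exact .app o (fun i e => (ts i).eval (g e)) ih

theorem IsPoly.mem_of_mem {f : (X → A) → A} (hf : IsPoly S f) {R : Set (A × A)}
    (hR : IsSubuniverse S R) (hrefl : ∀ a, (a, a) ∈ R) {x y : X → A}
    (h : ∀ i, (x i, y i) ∈ R) : (f x, f y) ∈ R := by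
  induction hf with
  | proj i => exact h i
  | const a => exact hrefl a
  | app o f _ ih => exact hR o (fun i => (f i x, f i y)) ih

/-- Unary polynomial operations. -/
def Poly1 (S : Signature) {A : Type} [SAlg S A] (f : A → A) : Prop :=
  IsPoly S fun e : Unit → A => f (e ())

/-- Binary polynomial operations. -/
def Poly2 (S : Signature) {A : Type} [SAlg S A] (f : A → A → A) : Prop :=
  IsPoly S fun e : Bool → A => f (e false) (e true)

/-- Ternary polynomial operations. -/
def Poly3 (S : Signature) {A : Type} [SAlg S A] (f : A → A → A → A) : Prop :=
  IsPoly S fun e : Fin 3 → A => f (e 0) (e 1) (e 2)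

theorem Poly1.comp {f : A → A} (hf : Poly1 S f) {a : (X → A) → A} (ha : IsPoly S a) :
    IsPoly S fun e => f (a e) :=
  IsPoly.comp hf (g := fun e _ => a e) fun _ => ha

theorem Poly2.comp {f : A → A → A} (hf : Poly2 S f) {a b : (X → A) → A} (ha : IsPoly S a)
    (hb : IsPoly S b) : IsPoly S fun e => f (a e) (b e) :=
  IsPoly.comp hf (g := fun e i => cond i (b e) (a e)) fun i => by cases i <;> assumption

theorem Poly3.comp {f : A → A → A → A} (hf : Poly3 S f) {a b c : (X → A) → A}
    (ha : IsPoly S a) (hb : IsPoly S b) (hc : IsPoly S c) :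
    IsPoly S fun e => f (a e) (b e) (c e) :=
  IsPoly.comp hf (g := fun e => ![a e, b e, c e]) fun i => by fin_cases i <;> assumption

theorem Poly1.iterate {a : (X → A) → A → A} {b : (X → A) → A}
    (ha : ∀ c : (X → A) → A, IsPoly S c → IsPoly S fun e => a e (c e)) (hb : IsPoly S b)
    (n : ℕ) : IsPoly S fun e => (a e)^[n] (b e) := by
  induction n with
  | zero => exact hb
  | succ n ih => simpa only [Function.iterate_succ_apply'] using ha _ ih

theorem Poly1.mem {f : A → A} (hf : Poly1 S f) {θ : Set (A × A)} (hθ : IsCongruence S θ)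
    {x y : A} (h : (x, y) ∈ θ) : (f x, f y) ∈ θ :=
  IsPoly.mem_of_mem (x := fun _ => x) (y := fun _ => y) hf hθ.1 hθ.2.refl fun _ => h

theorem Poly2.mem {f : A → A → A} (hf : Poly2 S f) {θ : Set (A × A)} (hθ : IsCongruence S θ)
    {x y z w : A} (h : (x, y) ∈ θ) (h' : (z, w) ∈ θ) : (f x z, f y w) ∈ θ :=
  IsPoly.mem_of_mem (x := fun i => cond i z x) (y := fun i => cond i w y) hf hθ.1 hθ.2.refl
    fun i => by cases i <;> assumption

theorem Poly3.mem {f : A → A → A → A} (hf : Poly3 S f) {θ : Set (A × A)}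
    (hθ : IsCongruence S θ) {x y z x' y' z' : A} (h : (x, x') ∈ θ) (h' : (y, y') ∈ θ)
    (h'' : (z, z') ∈ θ) : (f x y z, f x' y' z') ∈ θ :=
  IsPoly.mem_of_mem (x := ![x, y, z]) (y := ![x', y', z']) hf hθ.1 hθ.2.refl
    fun i => by fin_cases i <;> assumption

/-- Changing a tuple `z` into a tuple `w` one coordinate at a time. -/
theorem update_induction {n : ℕ} {P : (Fin n → A) → Prop} {z w : Fin n → A} (h0 : P z)
    (step : ∀ c i, (∀ j, c j = z j ∨ c j = w j) → c i = z i → P c →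
      P (Function.update c i (w i))) : P w := by
  suffices h : ∀ s : Finset (Fin n), P (s.piecewise w z) by
    simpa using h Finset.univ
  intro s
  induction s using Finset.induction with
  | empty => simpa using h0
  | insert j s hj ih =>
    rw [Finset.piecewise_insert]
    refine step _ j (fun k => ?_) ?_ ih
    · by_cases hk : k ∈ s <;> simp [hk]
    · simp [hj]

theorem IsPoly.update {n : ℕ} (c : (X → A) → Fin n → A) (hc : ∀ i, IsPoly S fun e => c e i)
    (i : Fin n) {a : (X → A) → A} (ha : IsPoly S a) (j : Fin n) :
    IsPoly S fun e => Function.update (c e) i (a e) j := by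
  by_cases hj : j = i
  · subst hj; simpa using ha
  · simpa [hj] using hc j

theorem isSubuniverse_of_poly1 {θ : Set (A × A)} (heq : Equivalence fun a b => (a, b) ∈ θ)
    (h1 : ∀ q : A → A, Poly1 S q → ∀ a b, (a, b) ∈ θ → (q a, q b) ∈ θ) :
    IsSubuniverse S θ := by
  intro o x hx
  refine update_induction (z := fun i => (x i).1) (w := fun i => (x i).2)
    (P := fun w => (SAlg.interp o (fun i => (x i).1), SAlg.interp o w) ∈ θ) (heq.refl _) ?_
  intro c i _ hci hc
  refine heq.trans hc ?_
  have hq : Poly1 S fun a => SAlg.interp o (Function.update c i a) :=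
    .app o (fun j e => Function.update c i (e ()) j)
      fun j => IsPoly.update (fun _ => c) (fun k => .const (c k)) i (.proj ()) j
  have := h1 _ hq _ _ (hx i)
  rwa [← hci, Function.update_eq_self] at this

theorem IsMonolith.eqvGen {μ : Set (A × A)} (hμ : IsMonolith S μ) {R : A → A → Prop}
    (hR : ∀ q : A → A, Poly1 S q → ∀ a b, R a b → R (q a) (q b)) {x y u v : A} (hxy : x ≠ y)
    (hRxy : R x y) (huv : (u, v) ∈ μ) : Relation.EqvGen R u v := by
  have heq : Equivalence fun a b => (a, b) ∈ {p : A × A | Relation.EqvGen R p.1 p.2} :=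
    Relation.EqvGen.is_equivalence R
  refine hμ.2.2 {p | Relation.EqvGen R p.1 p.2} ⟨isSubuniverse_of_poly1 heq ?_, heq⟩ ?_ huv
  · intro q hq a b hab
    change Relation.EqvGen R a b at hab
    change Relation.EqvGen R (q a) (q b)
    induction hab with
    | rel a b h => exact .rel _ _ (hR q hq _ _ h)
    | refl a => exact .refl _
    | symm a b _ ih => exact .symm _ _ ih
    | trans a b c _ _ ih ih' => exact .trans _ _ _ ih ih'
  · intro h
    have : (x, y) ∈ {p : A × A | Relation.EqvGen R p.1 p.2} := .rel _ _ hRxy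
    rw [h] at this
    exact hxy this

theorem iff_of_eqvGen {R : A → A → Prop} {f : A → Prop} (hf : ∀ a b, R a b → (f a ↔ f b))
    {u v : A} (h : Relation.EqvGen R u v) : f u ↔ f v := by
  induction h with
  | rel a b h => exact hf _ _ h
  | refl a => rfl
  | symm a b _ ih => exact ih.symm
  | trans a b c _ _ ih ih' => exact ih.trans ih'

/-- Polynomial images of any nontrivial pair connect the blocks of the monolith. -/
theorem IsMonolith.exists_link {μ : Set (A × A)} (hμ : IsMonolith S μ) {x y u v : A}
    (hxy : x ≠ y) (huv : (u, v) ∈ μ) (f : A → Prop) (hu : f u) (hv : ¬ f v) :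
    ∃ q : A → A, Poly1 S q ∧ ¬ (f (q x) ↔ f (q y)) := by
  by_contra! hcon
  have := hμ.eqvGen (R := fun a b => ∃ q : A → A, Poly1 S q ∧ a = q x ∧ b = q y)
    (by
      rintro p hp a b ⟨q, hq, rfl, rfl⟩
      exact ⟨fun a => p (q a), hp.comp hq, rfl, rfl⟩)
    hxy ⟨id, .proj (), rfl, rfl⟩ huv
  refine hv ((iff_of_eqvGen ?_ this).1 hu)
  rintro a b ⟨q, hq, rfl, rfl⟩
  exact hcon q hq

theorem exists_iterate_eq [Finite A] (N : Set A) : ∃ k : ℕ, ∀ h : A → A, (∀ x ∈ N, h x ∈ N) →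
    (∀ x ∈ N, ∀ y ∈ N, h x = h y → x = y) → ∀ x ∈ N, h^[k + 1] x = x := by
  refine ⟨Nat.card (Equiv.Perm N) - 1, fun h hm hi x hx => ?_⟩
  rw [Nat.sub_add_cancel Nat.card_pos]
  let φ : N → N := fun x => ⟨h x, hm x x.2⟩
  have hφ : Function.Injective φ := fun x y hxy =>
    Subtype.ext (hi x x.2 y y.2 (congrArg Subtype.val hxy))
  let σ : Equiv.Perm N := Equiv.ofBijective φ (Finite.injective_iff_bijective.1 hφ)
  have key : ∀ n : ℕ, ((σ ^ n) ⟨x, hx⟩ : N) = h^[n] x := by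
    intro n
    induction n with
    | zero => rfl
    | succ n ih =>
      rw [pow_succ', Function.iterate_succ_apply', ← ih]
      rfl
  rw [← key, pow_card_eq_one']
  rfl

/-- A centralizing pair of congruences satisfies the term condition for binary polynomials. -/
theorem Centralizes.poly2 [Finite A] {φ θ δ : Set (A × A)} (hC : Centralizes S φ θ δ)
    (hrefl : ∀ a, (a, a) ∈ θ) {g : A → A → A} (hg : Poly2 S g) {a b c d : A}
    (hab : (a, b) ∈ φ) (hcd : (c, d) ∈ θ) (h : (g a c, g a d) ∈ δ) : (g b c, g b d) ∈ δ := by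
  obtain ⟨n, ⟨ε⟩⟩ := Finite.exists_equiv_fin (Option A)
  have key : ∀ f : (Bool → A) → A, IsPoly S f → ∃ t : STerm S (n + 1), ∀ e : Bool → A,
      f e = t.eval (Fin.cons (e false) fun j => (ε.symm j).getD (e true)) := by
    intro f hf
    induction hf with
    | proj i =>
      cases i with
      | false => exact ⟨.var 0, fun e => rfl⟩
      | true => exact ⟨.var (Fin.succ (ε none)), fun e => by simp [STerm.eval]⟩
    | const a => exact ⟨.var (Fin.succ (ε (some a))), fun e => by simp [STerm.eval]⟩
    | app o f _ ih =>
      choose t ht using ih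
      exact ⟨.app o t, fun e => by simp only [STerm.eval, ht]⟩
  obtain ⟨t, ht⟩ := key _ hg
  have h' : ∀ x y, g x y = t.eval (Fin.cons x fun j => (ε.symm j).getD y) :=
    fun x y => ht (fun i => cond i y x)
  rw [h', h'] at h ⊢
  refine hC n t a b _ _ hab (fun j => ?_) h
  cases ε.symm j with
  | none => exact hcd
  | some a => exact hrefl a

end Polynomials

section MinimalSets

variable {S : Signature} {A : Type} [SAlg S A]

/-- `e` is an idempotent polynomial whose range is a minimal set for the congruence `μ`. -/
structure IsMinRetraction (S : Signature) {A : Type} [SAlg S A] (μ : Set (A × A)) (e : A → A) :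
    Prop where
  poly : Poly1 S e
  idem : ∀ x, e (e x) = e x
  sep : ∃ x y, (x, y) ∈ μ ∧ e x ≠ e y
  dich : ∀ q : A → A, Poly1 S q → (∀ x, e (q x) = q x) →
    (∀ x y, (x, y) ∈ μ → e x = x → e y = y → q x = q y) ∨
      ∀ x y, e x = x → e y = y → q x = q y → x = y

/-- The `μ`-block of `n` inside the range of `e`. -/
def block (μ : Set (A × A)) (e : A → A) (n : A) : Set A := {x | e x = x ∧ (n, x) ∈ μ}

/-- A semilattice polynomial on a two-element trace `{o, i}` of `ν`. -/
def HasMeet (S : Signature) {A : Type} [SAlg S A] (ν : Set (A × A)) : Prop :=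
  ∃ (o i : A) (r : A → A) (s : A → A → A), o ≠ i ∧ (o, i) ∈ ν ∧ Poly1 S r ∧ Poly2 S s ∧
    r o = o ∧ r i = i ∧ (∀ z, (o, z) ∈ ν → r z = o ∨ r z = i) ∧
    s o o = o ∧ s o i = o ∧ s i o = o ∧ s i i = i

theorem IsMonolith.exists_isMinRetraction [Finite A] {μ : Set (A × A)} (hμ : IsMonolith S μ) :
    ∃ e, IsMinRetraction S μ e := by
  let F : Set (A → A) := {f | Poly1 S f ∧ ∃ x y, (x, y) ∈ μ ∧ f x ≠ f y}
  have hF : F.Nonempty := by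
    by_contra hne
    apply hμ.2.1
    ext ⟨x, y⟩
    constructor
    · intro hxy
      by_contra h
      exact hne ⟨id, .proj (), x, y, hxy, h⟩
    · rintro (rfl : x = y)
      exact hμ.1.2.refl x
  obtain ⟨f, ⟨hf, x, y, hxy, hfxy⟩, hmin⟩ :=
    exists_minimalFor_of_wellFoundedLT (· ∈ F) (fun f => (Set.range f).ncard) hF
  have hmin' : ∀ g, Poly1 S g → (∃ x y, (x, y) ∈ μ ∧ g x ≠ g y) → Set.range g ⊆ Set.range f →
      Set.range g = Set.range f := fun g hg hs hsub =>
    Set.eq_of_subset_of_ncard_le hsub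
      (hmin (j := g) ⟨hg, hs⟩ (Set.ncard_le_ncard hsub (Set.toFinite _))) (Set.toFinite _)
  have inj_of : ∀ q g : A → A, Set.range g = Set.range f →
      Set.range (fun x => q (g x)) = Set.range f → Set.InjOn q (Set.range f) := by
    intro q g hg hq
    refine Set.injOn_of_ncard_image_eq ?_ (Set.toFinite _)
    rw [← hg, ← Set.range_comp, hg]
    exact congrArg Set.ncard hq
  obtain ⟨q, hq, hne⟩ := hμ.exists_link hfxy hxy (fun z => f z = f x) rfl (fun h => hfxy h.symm)
  have hne' : f (q (f x)) ≠ f (q (f y)) := fun h => hne (by rw [h])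
  let h : A → A := fun z => f (q z)
  have hh : Poly1 S h := hf.comp hq
  have hrange : Set.range (fun z => h (f z)) = Set.range f :=
    hmin' _ (hh.comp hf) ⟨x, y, hxy, hne'⟩ (by rintro _ ⟨z, rfl⟩; exact ⟨_, rfl⟩)
  obtain ⟨k, hk⟩ := exists_iterate_eq (Set.range f)
  have hfix := hk h (fun z _ => ⟨q z, rfl⟩) fun z hz w hw => inj_of h f rfl hrange hz hw
  have hmem : ∀ z, h^[k + 1] z ∈ Set.range f := fun z => by
    rw [Function.iterate_succ_apply']
    exact ⟨_, rfl⟩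
  have he : Poly1 S (h^[k + 1]) :=
    Poly1.iterate (a := fun _ => h) (fun c hc => hh.comp hc) (.proj ()) _
  refine ⟨h^[k + 1], he, fun z => hfix _ (hmem z), ⟨f x, f y, hf.mem hμ.1 hxy, ?_⟩, ?_⟩
  · rwa [hfix _ ⟨x, rfl⟩, hfix _ ⟨y, rfl⟩]
  · intro p hp hep
    by_cases hcol : ∀ x y, (x, y) ∈ μ → h^[k + 1] x = x → h^[k + 1] y = y → p x = p y
    · exact .inl hcol
    · right
      push Not at hcol
      obtain ⟨z, w, hzw, hz, hw, hpzw⟩ := hcol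
      obtain ⟨z', rfl⟩ : z ∈ Set.range f := hz ▸ hmem z
      obtain ⟨w', rfl⟩ : w ∈ Set.range f := hw ▸ hmem w
      have hrange_e : Set.range (h^[k + 1]) = Set.range f := by
        refine Set.Subset.antisymm (by rintro _ ⟨z, rfl⟩; exact hmem z) ?_
        rintro _ ⟨z, rfl⟩
        exact ⟨f z, hfix _ ⟨z, rfl⟩⟩
      have hr : Set.range (fun z => p (h^[k + 1] z)) = Set.range f := by
        refine hmin' _ (hp.comp he) ⟨_, _, hzw, by rwa [hz, hw]⟩ ?_
        rintro _ ⟨z, rfl⟩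
        change p (h^[k + 1] z) ∈ _
        rw [← hep]
        exact hmem _
      intro a b ha hb hab
      exact inj_of p _ hrange_e hr (ha ▸ hmem a) (hb ▸ hmem b) hab

variable {μ : Set (A × A)} {e : A → A}

theorem IsMinRetraction.dich_block (he : IsMinRetraction S μ e) (hμ : IsCongruence S μ) {n : A}
    {q : A → A} (hq : Poly1 S q) (hqN : ∀ x ∈ block μ e n, q x ∈ block μ e n) :
    (∀ x ∈ block μ e n, ∀ y ∈ block μ e n, q x = q y) ∨
      ∀ x ∈ block μ e n, ∀ y ∈ block μ e n, q x = q y → x = y := by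
  have hid : ∀ x ∈ block μ e n, e (q x) = q x := fun x hx => (hqN x hx).1
  rcases he.dich (fun x => e (q x)) (he.poly.comp hq) (fun x => he.idem _) with h | h
  · left
    intro x hx y hy
    rw [← hid x hx, ← hid y hy]
    exact h x y (hμ.2.trans (hμ.2.symm hx.2) hy.2) hx.1 hy.1
  · right
    intro x hx y hy hxy
    exact h x y hx.1 hy.1 (congrArg e hxy)

theorem IsMinRetraction.hasMeet [Finite A] (he : IsMinRetraction S μ e) (hμ : IsCongruence S μ)
    {n : A} {g : A → A → A} (hg : Poly2 S g)
    (hgN : ∀ x ∈ block μ e n, ∀ y ∈ block μ e n, g x y ∈ block μ e n)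
    {c d : A} (hc : c ∈ block μ e n) (hd : d ∈ block μ e n)
    (hconst : ∀ x ∈ block μ e n, ∀ y ∈ block μ e n, g x c = g y c)
    {u v : A} (hu : u ∈ block μ e n) (hv : v ∈ block μ e n) (huv : g u d ≠ g v d) :
    HasMeet S μ := by
  set N := block μ e n with hN
  obtain ⟨k, hk⟩ := exists_iterate_eq N
  let G : A → A → A := fun x y => (fun z => g z y)^[k + 1] x
  have hG : Poly2 S G := Poly1.iterate (a := fun (e : Bool → A) z => g z (e true))
    (fun c hc => hg.comp hc (.proj true)) (.proj false) _
  have hiter : ∀ m, ∀ x ∈ N, ∀ y ∈ N, (fun z => g z y)^[m] x ∈ N := by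
    intro m x hx y hy
    induction m with
    | zero => exact hx
    | succ m ih => rw [Function.iterate_succ_apply']; exact hgN _ ih _ hy
  have hGN : ∀ x ∈ N, ∀ y ∈ N, G x y ∈ N := hiter _
  have hGconst : ∀ y ∈ N, (∀ x ∈ N, ∀ z ∈ N, g x y = g z y) → ∀ x ∈ N, ∀ z ∈ N, G x y = G z y := by
    intro y hy h x hx z hz
    simp only [G, Function.iterate_succ_apply']
    exact h _ (hiter k x hx y hy) _ (hiter k z hz y hy)
  have hGid : ∀ y ∈ N, (∀ x ∈ N, ∀ z ∈ N, g x y = g z y → x = z) → ∀ x ∈ N, G x y = x :=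
    fun y hy h x hx => hk (fun z => g z y) (fun z hz => hgN z hz y hy) h x hx
  have hunary : ∀ y, Poly1 S fun z => g z y := fun y => hg.comp (.proj ()) (.const y)
  have hGc := hGconst c hc hconst
  have hGd : ∀ x ∈ N, G x d = x := by
    rcases he.dich_block hμ (hunary d) (fun z hz => hgN z hz d hd) with h | h
    · exact absurd (h u hu v hv) huv
    · exact hGid d hd h
  have hcd : c ≠ d := by
    rintro rfl
    exact huv (hconst u hu v hv)
  let o := G c c
  have ho : o ∈ N := hGN c hc c hc
  have hoc : ∀ x ∈ N, G x c = o := fun x hx => hGc x hx c hc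
  have hdichG : ∀ x ∈ N, (∀ y ∈ N, ∀ z ∈ N, G x y = G x z) ∨
      ∀ y ∈ N, ∀ z ∈ N, G x y = G x z → y = z :=
    fun x hx => he.dich_block hμ (q := G x) (hG.comp (.const x) (.proj ()))
      fun y hy => hGN x hx y hy
  have hoy : ∀ y ∈ N, G o y = o := by
    rcases hdichG o ho with h | h
    · intro y hy
      rw [h y hy c hc, hoc o ho]
    · exact absurd (h c hc d hd (by rw [hoc o ho, hGd o ho])) hcd
  obtain ⟨i, hi, hio⟩ : ∃ i ∈ N, i ≠ o := by
    by_cases h : c = o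
    · exact ⟨d, hd, fun h' => hcd (h.trans h'.symm)⟩
    · exact ⟨c, hc, h⟩
  have hinj : ∀ y ∈ N, ∀ z ∈ N, G i y = G i z → y = z := by
    rcases hdichG i hi with h | h
    · exact absurd ((hGd i hi).symm.trans ((h d hd c hc).trans (hoc i hi))) hio
    · exact h
  have hval : ∀ y ∈ N, G i y = i ∨ G i y = o := by
    intro y hy
    rcases he.dich_block hμ (hunary y) (fun z hz => hgN z hz y hy) with h | h
    · right
      rw [hGconst y hy h i hi o ho, hoy y hy]
    · exact .inl (hGid y hy h i hi)
  have hNcd : ∀ y ∈ N, y = c ∨ y = d := by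
    intro y hy
    rcases hval y hy with h | h
    · exact .inr (hinj y hy d hd (h.trans (hGd i hi).symm))
    · exact .inl (hinj y hy c hc (h.trans (hoc i hi).symm))
  have hrel : ∀ x ∈ N, ∀ y ∈ N, (x, y) ∈ μ := fun x hx y hy => hμ.2.trans (hμ.2.symm hx.2) hy.2
  have hmemN : ∀ x ∈ N, ∀ z, (x, z) ∈ μ → e z ∈ N := by
    intro x hx z hz
    refine ⟨he.idem z, hμ.2.trans hx.2 ?_⟩
    have := he.poly.mem hμ hz
    rwa [hx.1] at this
  rcases hNcd o ho with h | h
  · exact ⟨c, d, e, G, hcd, hrel c hc d hd, he.poly, hG, hc.1, hd.1,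
      fun z hz => hNcd _ (hmemN c hc z hz), h, hGd c hc, (hoc d hd).trans h, hGd d hd⟩
  · have hGcc : G c c = d := h
    have hdy : ∀ y ∈ N, G d y = d := h ▸ hoy
    refine ⟨d, c, e, fun x y => G x (G x y), hcd.symm, hrel d hd c hc, he.poly,
      hG.comp (.proj false) hG, hd.1, hc.1, fun z hz => (hNcd _ (hmemN d hd z hz)).symm,
      ?_, ?_, ?_, ?_⟩
    · simp only [hdy d hd]
    · simp only [hdy c hc, hdy d hd]
    · simp only [hGd c hc, hGcc]
    · simp only [hGcc, hGd c hc]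

/-- Without semilattice polynomials, a binary polynomial on a block that depends on both
variables is a quasigroup operation, and so yields a Maltsev polynomial. -/
theorem IsMinRetraction.exists_maltsev_of_binary [Finite A] (he : IsMinRetraction S μ e)
    (hμ : IsCongruence S μ) (hno : ¬ HasMeet S μ) {n : A} {g : A → A → A} (hg : Poly2 S g)
    (hgN : ∀ x ∈ block μ e n, ∀ y ∈ block μ e n, g x y ∈ block μ e n)
    {x₁ x₂ y₀ x₀ y₁ y₂ : A} (hx₁ : x₁ ∈ block μ e n) (hx₂ : x₂ ∈ block μ e n)
    (hy₀ : y₀ ∈ block μ e n) (hx₀ : x₀ ∈ block μ e n) (hy₁ : y₁ ∈ block μ e n)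
    (hy₂ : y₂ ∈ block μ e n) (hl : g x₁ y₀ ≠ g x₂ y₀) (hr : g x₀ y₁ ≠ g x₀ y₂) :
    ∃ p : A → A → A → A, Poly3 S p ∧ (∀ x y z, e (p x y z) = p x y z) ∧
      ∀ x ∈ block μ e n, ∀ y ∈ block μ e n, p x x y = y ∧ p x y y = x := by
  set N := block μ e n with hN
  have hinjl : ∀ y ∈ N, ∀ x ∈ N, ∀ z ∈ N, g x y = g z y → x = z := by
    intro y hy
    rcases he.dich_block hμ (q := fun x => g x y) (hg.comp (.proj ()) (.const y))
      (fun z hz => hgN z hz y hy) with h | h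
    · exact absurd (he.hasMeet hμ hg hgN hy hy₀ h hx₁ hx₂ hl) hno
    · exact h
  have hinjr : ∀ x ∈ N, ∀ y ∈ N, ∀ z ∈ N, g x y = g x z → y = z := by
    intro x hx
    rcases he.dich_block hμ (q := fun y => g x y) (hg.comp (.const x) (.proj ()))
      (fun z hz => hgN x hx z hz) with h | h
    · exact absurd (he.hasMeet hμ (g := fun y x => g x y) (hg.comp (.proj true) (.proj false))
        (fun x hx y hy => hgN y hy x hx) hx hx₀ h hy₁ hy₂ hr) hno
    · exact h
  obtain ⟨k, hk⟩ := exists_iterate_eq N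
  let L : A → A → A := fun x z => (fun y => g x y)^[k] z
  let R : A → A → A := fun x z => (fun y => g y z)^[k] x
  have hL : Poly2 S L := Poly1.iterate (a := fun (e : Bool → A) z => g (e false) z)
    (fun c hc => hg.comp (.proj false) hc) (.proj true) _
  have hR : Poly2 S R := Poly1.iterate (a := fun (e : Bool → A) z => g z (e true))
    (fun c hc => hg.comp hc (.proj true)) (.proj false) _
  have hLN : ∀ x ∈ N, ∀ z ∈ N, L x z ∈ N := fun x hx z hz =>
    Set.MapsTo.iterate (f := fun y => g x y) (s := N) (fun y hy => hgN x hx y hy) k hz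
  have hgL : ∀ x ∈ N, ∀ z ∈ N, g x (L x z) = z := by
    intro x hx z hz
    have := hk (fun y => g x y) (fun y hy => hgN x hx y hy) (hinjr x hx) z hz
    rwa [Function.iterate_succ_apply'] at this
  have hRg : ∀ x ∈ N, ∀ z ∈ N, R (g x z) z = x := by
    intro x hx z hz
    have := hk (fun y => g y z) (fun y hy => hgN y hy z hz) (hinjl z hz) x hx
    rwa [Function.iterate_succ_apply] at this
  have hgR : ∀ x ∈ N, ∀ z ∈ N, g (R x z) z = x := by
    intro x hx z hz
    have := hk (fun y => g y z) (fun y hy => hgN y hy z hz) (hinjl z hz) x hx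
    rwa [Function.iterate_succ_apply'] at this
  refine ⟨fun x y z => e (g (R x (L y y)) (L y z)), ?_, fun x y z => he.idem _, ?_⟩
  · exact he.poly.comp (hg.comp (hR.comp (.proj 0) (hL.comp (.proj 1) (.proj 1)))
      (hL.comp (.proj 1) (.proj 2)))
  · intro x hx y hy
    constructor
    · have h1 : R x (L x x) = x := by
        conv_lhs => rw [← hgL x hx x hx]
        rw [hgL x hx x hx]
        have := hRg x hx (L x x) (hLN x hx x hx)
        rwa [hgL x hx x hx] at this
      simp only [h1, hgL x hx y hy, hy.1]
    · simp only [hgR x hx (L y y) (hLN y hy y hy), hx.1]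

theorem IsMinRetraction.exists_maltsev [Finite A] (he : IsMinRetraction S μ e)
    (hμ : IsCongruence S μ) (hno : ¬ HasMeet S μ) (hTay : IsTaylorAlg S A) {n a b : A}
    (ha : a ∈ block μ e n) (hb : b ∈ block μ e n) (hab : a ≠ b) :
    ∃ p : A → A → A → A, Poly3 S p ∧ (∀ x y z, e (p x y z) = p x y z) ∧
      ∀ x ∈ block μ e n, ∀ y ∈ block μ e n, p x x y = y ∧ p x y y = x := by
  obtain ⟨m, t, u, v, -, huv, hidem, hid⟩ := hTay
  set N := block μ e n with hN
  let h : (Fin m → A) → A := fun x => e (t.eval x)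
  have hh : IsPoly S h := he.poly.comp (t.isPoly_eval fun i => .proj i)
  have hhN : ∀ x : Fin m → A, (∀ i, x i ∈ N) → h x ∈ N := by
    intro x hx
    refine ⟨he.idem _, ?_⟩
    have := IsPoly.mem_of_mem hh hμ.1 hμ.2.refl (x := fun _ => a) (y := x)
      fun i => hμ.2.trans (hμ.2.symm ha.2) (hx i).2
    refine hμ.2.trans ha.2 ?_
    have h' : h (fun _ => a) = a := by simp only [h, hidem, ha.1]
    rwa [h'] at this
  have hupdN : ∀ (c : Fin m → A) (i : Fin m) (x : A), (∀ j, c j ∈ N) → x ∈ N →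
      ∀ j, Function.update c i x j ∈ N := by
    intro c i x hc hx j
    by_cases hj : j = i
    · subst hj; simpa
    · simpa [hj] using hc j
  have hpoly : ∀ (c : Fin m → A) (i j : Fin m), Poly2 S fun x y =>
      h (Function.update (Function.update c i x) j y) := fun c i j =>
    hh.comp fun k => IsPoly.update _
      (fun k => IsPoly.update (fun _ => c) (fun l => .const (c l)) i (.proj false) k) j
      (.proj true) k
  by_contra hcon
  -- no binary specialization of `h` depends on both of its variables
  have hone : ∀ (c : Fin m → A) (i j : Fin m), i ≠ j → (∀ k, c k ∈ N) → ∀ x ∈ N, ∀ y ∈ N,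
      h (Function.update c i x) ≠ h c → h (Function.update c j y) = h c := by
    intro c i j hij hc x hx y hy hx'
    by_contra hy'
    refine hcon (he.exists_maltsev_of_binary hμ hno (hpoly c i j)
      (fun x hx y hy => hhN _ (hupdN _ _ _ (hupdN _ _ _ hc hx) hy))
      hx (hc i) (hc j) (hc i) hy (hc j) ?_ ?_)
    · have : Function.update (Function.update c i x) j (c j) = Function.update c i x := by
        rw [Function.update_eq_iff]
        exact ⟨by simp [hij.symm], fun k _ => rfl⟩
      rwa [this, Function.update_eq_self, Function.update_eq_self]
    · rwa [Function.update_eq_self, Function.update_eq_self]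
  -- injectivity in a variable does not depend on the other coordinates
  let Inj : Fin m → (Fin m → A) → Prop := fun i c =>
    ∀ x ∈ N, ∀ y ∈ N, h (Function.update c i x) = h (Function.update c i y) → x = y
  have hInj_of_ne : ∀ c i, (∀ k, c k ∈ N) → ∀ x ∈ N, h (Function.update c i x) ≠ h c → Inj i c := by
    intro c i hc x hx hne
    rcases he.dich_block hμ (q := fun z => h (Function.update c i z))
      (hh.comp fun k => IsPoly.update (fun _ => c) (fun l => .const (c l)) i (.proj ()) k)
      (fun z hz => hhN _ (hupdN _ _ _ hc hz)) with h' | h'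
    · have := h' x hx (c i) (hc i)
      rw [Function.update_eq_self] at this
      exact absurd this hne
    · exact h'
  have hInj_ne : ∀ c i, (∀ k, c k ∈ N) → Inj i c → ∃ x ∈ N, h (Function.update c i x) ≠ h c := by
    intro c i hc hi
    by_contra! hall
    exact hab (hi a ha b hb ((hall a ha).trans (hall b hb).symm))
  have hInj_step : ∀ c i j, (∀ k, c k ∈ N) → ∀ y ∈ N, Inj i c →
      Inj i (Function.update c j y) := by
    intro c i j hc y hy hi
    by_cases hij : i = j
    · subst hij
      simpa only [Inj, Function.update_idem] using hi
    · intro x hx z hz hxz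
      by_contra hne
      obtain ⟨w, hw, hwne⟩ := hInj_ne c i hc hi
      rcases he.dich_block hμ (q := fun x => h (Function.update (Function.update c j y) i x))
        (hh.comp fun k => IsPoly.update (fun _ => Function.update c j y) (fun l => .const _) i
          (.proj ()) k)
        (fun z hz => hhN _ (hupdN _ _ _ (hupdN _ _ _ hc hy) hz)) with h' | h'
      · refine hno (he.hasMeet hμ (n := n)
          (g := fun x y => h (Function.update (Function.update c j y) i x))
          ((hpoly c j i).comp (.proj true) (.proj false))
          (fun x hx y hy => hhN _ (hupdN _ _ _ (hupdN _ _ _ hc hy) hx)) hy (hc j) h' hw (hc i) ?_)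
        rw [Function.update_eq_self, Function.update_eq_self]
        exact hwne
      · exact hne (h' x hx z hz hxz)
  obtain ⟨i, c, hc, hic⟩ : ∃ i c, (∀ k, c k ∈ N) ∧ Inj i c := by
    by_contra! hnone
    have : h (fun _ => a) = h (fun _ => b) := by
      refine (update_induction (z := fun _ => a) (w := fun _ => b)
        (P := fun c => (∀ k, c k ∈ N) ∧ h (fun _ => a) = h c) ⟨fun _ => ha, rfl⟩ ?_).2
      rintro c i - - ⟨hc, hcc⟩
      refine ⟨hupdN _ _ _ hc hb, hcc.trans ?_⟩
      by_contra hne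
      exact hnone i c hc (hInj_of_ne c i hc b hb fun h' => hne h'.symm)
    simp only [h, hidem, ha.1, hb.1] at this
    exact hab this
  have hInj : ∀ c', (∀ k, c' k ∈ N) → Inj i c' := by
    intro c' hc'
    refine (update_induction (z := c) (w := c') (P := fun c => (∀ k, c k ∈ N) ∧ Inj i c)
      ⟨hc, hic⟩ ?_).2
    rintro c j - - ⟨hc, hcc⟩
    exact ⟨hupdN _ _ _ hc (hc' j), hInj_step _ _ _ hc _ (hc' j) hcc⟩
  have hrest : ∀ z w : Fin m → A, (∀ k, z k ∈ N) → (∀ k, w k ∈ N) → z i = w i → h z = h w := by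
    intro z w hz hw hi
    refine (update_induction (z := z) (w := w) (P := fun c => (∀ k, c k ∈ N) ∧ h z = h c)
      ⟨hz, rfl⟩ ?_).2
    rintro c j hcj hcz ⟨hc, hcc⟩
    refine ⟨hupdN _ _ _ hc (hw j), hcc.trans ?_⟩
    by_cases hij : i = j
    · subst hij
      rw [← hi, ← hcz, Function.update_eq_self]
    · obtain ⟨x, hx, hne⟩ := hInj_ne c i hc (hInj c hc)
      exact (hone c i j hij hc x hx _ (hw j) hne).symm
  have hsel : ∀ z : Fin m → A, (∀ k, z k ∈ N) → h z = z i := by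
    intro z hz
    rw [hrest z (fun _ => z i) hz (fun _ => hz i) rfl]
    simp only [h, hidem, (hz i).1]
  have hfin : ∀ f : Fin m → Fin 2, ∀ k, (if f k = 0 then a else b) ∈ N := by
    intro f k
    split_ifs <;> assumption
  have := congrArg e (hid i a b)
  change h _ = h _ at this
  rw [hsel _ (hfin _), hsel _ (hfin _)] at this
  refine huv i ?_
  have hne : ∀ x y : Fin 2, ((if x = 0 then a else b) = if y = 0 then a else b) → x = y := by
    intro x y hxy
    fin_cases x <;> fin_cases y <;> simp_all
  exact hne _ _ this

end MinimalSets

section Abelian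

variable {S : Signature} {A : Type} [SAlg S A] {μ : Set (A × A)} {e : A → A}

/-- Distinct elements are separated by polynomials into a minimal set. -/
theorem IsMinRetraction.exists_separating (he : IsMinRetraction S μ e) (hμ : IsMonolith S μ)
    {a b : A} (hab : a ≠ b) :
    ∃ q : A → A, Poly1 S q ∧ (∀ x, e (q x) = q x) ∧ q a ≠ q b := by
  obtain ⟨x, y, hxy, hne⟩ := he.sep
  obtain ⟨q, hq, h⟩ := hμ.exists_link hab hxy (fun z => e z = e x) rfl (fun h => hne h.symm)
  refine ⟨fun z => e (q z), he.poly.comp hq, fun z => he.idem _, fun h' => h ?_⟩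
  change e (q a) = e (q b) at h'
  rw [h']

theorem not_hasMeet_of_centralizes [Finite A] (hμ : IsCongruence S μ)
    (hC : Centralizes S μ μ (diag A)) : ¬ HasMeet S μ := by
  rintro ⟨o, i, r, s, hoi, hmem, -, hs, -, -, -, hoo, hoi', hio, hii⟩
  have := hC.poly2 hμ.2.refl hs hmem hmem (hoo.trans hoi'.symm)
  change s i o = s i i at this
  rw [hio, hii] at this
  exact hoi this

theorem IsMonolith.exists_maltsev_pair [Finite A] (hμ : IsMonolith S μ) (hTay : IsTaylorAlg S A)
    (hC : Centralizes S μ μ (diag A)) {a b : A} (hab : a ≠ b) (hmem : (a, b) ∈ μ) :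
    ∃ P : A → A → A → A, Poly3 S P ∧ P a a b = P b b b ∧ P b a a = P b b b ∧
      P a a a ≠ P b b b := by
  obtain ⟨e, he⟩ := hμ.exists_isMinRetraction
  obtain ⟨q, hq, heq, hne⟩ := he.exists_separating hμ hab
  have hqa : q a ∈ block μ e (q a) := ⟨heq a, hμ.1.2.refl _⟩
  have hqb : q b ∈ block μ e (q a) := ⟨heq b, hq.mem hμ.1 hmem⟩
  obtain ⟨p, hp, -, hmal⟩ := he.exists_maltsev hμ.1 (not_hasMeet_of_centralizes hμ.1 hC) hTay
    hqa hqb hne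
  refine ⟨fun x y z => p (q x) (q y) (q z),
    hp.comp (hq.comp (.proj 0)) (hq.comp (.proj 1)) (hq.comp (.proj 2)), ?_, ?_, ?_⟩
  · simp only [(hmal _ hqa _ hqb).1, (hmal _ hqb _ hqb).1]
  · simp only [(hmal _ hqb _ hqa).2, (hmal _ hqb _ hqb).1]
  · simpa only [(hmal _ hqa _ hqa).1, (hmal _ hqb _ hqb).1] using hne

/-- In a Taylor algebra, a monolith without semilattice polynomials is abelian. -/
theorem IsMonolith.centralizes_of_not_hasMeet [Finite A] (hμ : IsMonolith S μ)
    (hTay : IsTaylorAlg S A) (hno : ¬ HasMeet S μ) : Centralizes S μ μ (diag A) := by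
  intro n t a b c d hab hcd h
  by_contra hne
  change ¬ t.eval (Fin.cons b c) = t.eval (Fin.cons b d) at hne
  change t.eval (Fin.cons a c) = t.eval (Fin.cons a d) at h
  obtain ⟨e, he⟩ := hμ.exists_isMinRetraction
  obtain ⟨q, hq, heq, hqne⟩ := he.exists_separating hμ hne
  have hrefl := hμ.1.2.refl
  let F : A → (Fin n → A) → A := fun x y => q (t.eval (Fin.cons x y))
  have hF : ∀ {X : Type} {f : (X → A) → A} {g : (X → A) → Fin n → A}, IsPoly S f →
      (∀ i, IsPoly S fun e => g e i) → IsPoly S fun e => F (f e) (g e) := by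
    intro X f g hf hg
    refine hq.comp (t.isPoly_eval fun i => ?_)
    refine Fin.cases ?_ (fun j => ?_) i
    · exact hf
    · exact hg j
  have hFmem : ∀ {x x' y y'}, (x, x') ∈ μ → (∀ i, (y i, y' i) ∈ μ) → (F x y, F x' y') ∈ μ := by
    intro x x' y y' hx hy
    have := IsPoly.mem_of_mem (S := S) (X := Option (Fin n))
      (hF (f := fun e => e none) (g := fun e i => e (some i)) (.proj _) fun i => .proj _)
      hμ.1.1 hrefl (x := fun o => o.elim x y) (y := fun o => o.elim x' y')
      fun o => by cases o with
        | none => exact hx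
        | some i => exact hy i
    exact this
  set u := F b c with hu
  set v := F b d with hv
  have huv : (u, v) ∈ μ := hFmem (hrefl b) hcd
  have huN : u ∈ block μ e u := ⟨heq _, hrefl u⟩
  have hvN : v ∈ block μ e u := ⟨heq _, huv⟩
  obtain ⟨p, hp, hep, hmal⟩ := he.exists_maltsev hμ.1 hno hTay huN hvN hqne
  have hFN : ∀ x y, (b, x) ∈ μ → (∀ i, (c i, y i) ∈ μ) → F x y ∈ block μ e u :=
    fun x y hx hy => ⟨heq _, hFmem hx hy⟩
  -- reduce the change in the first argument to a polynomial image of `{u, v}`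
  obtain ⟨q₁, hq₁, z, w, hz, hw, hbz, hbw, hFz, hFw⟩ : ∃ q₁ : A → A, Poly1 S q₁ ∧
      ∃ z w, z ∈ block μ e u ∧ w ∈ block μ e u ∧ (b, q₁ z) ∈ μ ∧ (b, q₁ w) ∈ μ ∧
        F (q₁ z) c = F (q₁ z) d ∧ F (q₁ w) c ≠ F (q₁ w) d := by
    obtain ⟨q₁, hq₁, hlink⟩ := hμ.exists_link hqne hab (fun x => (b, x) ∈ μ ∧ F x c = F x d)
      ⟨hμ.1.2.symm hab, congrArg q h⟩ (fun h' => hqne h'.2)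
    have key : ∀ z w, z ∈ block μ e u → w ∈ block μ e u →
        ((b, q₁ z) ∈ μ ∧ F (q₁ z) c = F (q₁ z) d) →
        ¬ ((b, q₁ w) ∈ μ ∧ F (q₁ w) c = F (q₁ w) d) →
        (b, q₁ z) ∈ μ ∧ (b, q₁ w) ∈ μ ∧ F (q₁ z) c = F (q₁ z) d ∧ F (q₁ w) c ≠ F (q₁ w) d := by
      intro z w hz hw h1 h2
      have hbw : (b, q₁ w) ∈ μ :=
        hμ.1.2.trans h1.1 (hq₁.mem hμ.1 (hμ.1.2.trans (hμ.1.2.symm hz.2) hw.2))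
      exact ⟨h1.1, hbw, h1.2, fun h' => h2 ⟨hbw, h'⟩⟩
    by_cases h1 : (b, q₁ u) ∈ μ ∧ F (q₁ u) c = F (q₁ u) d
    · exact ⟨q₁, hq₁, u, v, huN, hvN, key u v huN hvN h1 fun h2 => hlink (iff_of_true h1 h2)⟩
    · refine ⟨q₁, hq₁, v, u, hvN, huN, key v u hvN huN ?_ h1⟩
      by_contra h2
      exact hlink (iff_of_false h1 h2)
  let G : A → (Fin n → A) → A := fun x y => p (F x y) (F (q₁ z) y) (F (q₁ z) c)
  have hGconst : ∀ y, (∀ i, (c i, y i) ∈ μ) → G (q₁ z) y = F (q₁ z) c := fun y hy =>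
    (hmal _ (hFN _ y hbz hy) _ (hFN _ c hbz fun i => hrefl _)).1
  have hGne : G (q₁ w) c ≠ G (q₁ w) d := by
    have hc := hFN _ c hbz fun i => hrefl _
    simp only [G, ← hFz, (hmal _ (hFN _ c hbw fun i => hrefl _) _ hc).2,
      (hmal _ (hFN _ d hbw hcd) _ hc).2]
    exact hFw
  have hG : ∀ {X : Type} {f : (X → A) → A} {g : (X → A) → Fin n → A}, IsPoly S f →
      (∀ i, IsPoly S fun e => g e i) → IsPoly S fun e => G (f e) (g e) := fun hf hg =>
    hp.comp (hF hf hg) (hF (.const _) hg) (.const _)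
  have hGN : ∀ x y, (b, x) ∈ μ → (∀ i, (c i, y i) ∈ μ) → G x y ∈ block μ e u := by
    intro x y hx hy
    refine ⟨hep _ _ _, ?_⟩
    have h1 := hp.mem hμ.1 (hFN x y hx hy).2 (hFN (q₁ z) y hbz hy).2
      (hFN (q₁ z) c hbz fun i => hrefl _).2
    rwa [(hmal u huN u huN).1] at h1
  -- find one coordinate whose change is visible
  obtain ⟨c', i, hc', hci, hstep⟩ : ∃ (c' : Fin n → A) (i : Fin n), (∀ j, (c j, c' j) ∈ μ) ∧
      c' i = c i ∧ G (q₁ w) (Function.update c' i (d i)) ≠ G (q₁ w) c' := by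
    by_contra! hcon
    refine hGne (update_induction (z := c) (w := d)
      (P := fun y => G (q₁ w) c = G (q₁ w) y) rfl ?_)
    intro c' i hc' hci hP
    refine hP.trans (hcon c' i (fun j => ?_) hci).symm
    rcases hc' j with h' | h' <;> rw [h']
    exacts [hrefl _, hcd j]
  obtain ⟨q₂, hq₂, hlink⟩ := hμ.exists_link hqne (hcd i)
    (fun x => (c i, x) ∈ μ ∧ G (q₁ w) (Function.update c' i x) = G (q₁ w) c')
    ⟨hrefl _, by rw [← hci, Function.update_eq_self]⟩ fun h' => hstep h'.2
  have hq₂rel : ∀ x ∈ block μ e u, ∀ y ∈ block μ e u, (q₂ x, q₂ y) ∈ μ := fun x hx y hy =>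
    hq₂.mem hμ.1 (hμ.1.2.trans (hμ.1.2.symm hx.2) hy.2)
  have hq₂c : ∀ x ∈ block μ e u, (c i, q₂ x) ∈ μ := by
    by_contra! hcon
    obtain ⟨x, hx, hxc⟩ := hcon
    exact hlink (iff_of_false (fun h' => hxc (hμ.1.2.trans h'.1 (hq₂rel _ huN _ hx)))
      fun h' => hxc (hμ.1.2.trans h'.1 (hq₂rel _ hvN _ hx)))
  have hne₂ : G (q₁ w) (Function.update c' i (q₂ u)) ≠
      G (q₁ w) (Function.update c' i (q₂ v)) := by
    intro h'
    exact hlink ⟨fun h1 => ⟨hq₂c v hvN, h'.symm.trans h1.2⟩,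
      fun h1 => ⟨hq₂c u huN, h'.trans h1.2⟩⟩
  have hupd : ∀ y ∈ block μ e u, ∀ j, (c j, Function.update c' i (q₂ y) j) ∈ μ := by
    intro y hy j
    by_cases hj : j = i
    · subst hj; simpa using hq₂c y hy
    · simpa [hj] using hc' j
  have hbq : ∀ x ∈ block μ e u, (b, q₁ x) ∈ μ := fun x hx =>
    hμ.1.2.trans hbz (hq₁.mem hμ.1 (hμ.1.2.trans (hμ.1.2.symm hz.2) hx.2))
  refine hno (he.hasMeet hμ.1 (n := u)
    (g := fun y x => G (q₁ x) (Function.update c' i (q₂ y))) ?_ ?_ hz hw ?_ huN hvN hne₂)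
  · exact hG (hq₁.comp (.proj true)) fun j =>
      IsPoly.update (fun _ => c') (fun k => .const _) i (hq₂.comp (.proj false)) j
  · exact fun y hy x hx => hGN _ _ (hbq x hx) (hupd y hy)
  · intro x hx y hy
    exact (hGconst _ (hupd x hx)).trans (hGconst _ (hupd y hy)).symm

end Abelian

section Links

variable {S : Signature} {A B X : Type} [SAlg S A] [SAlg S B]

/-- A bridge between the equality relations of `A` and `B`, with anchors inside `μ` and `ν`. -/
structure IsLink (S : Signature) {A B : Type} [SAlg S A] [SAlg S B] (μ : Set (A × A))
    (ν : Set (B × B)) (T : A → A → B → B → Prop) : Prop where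
  compat : ∀ (o : S.ops) (x y : Fin (S.arity o) → A) (z w : Fin (S.arity o) → B),
    (∀ i, T (x i) (y i) (z i) (w i)) →
      T (SAlg.interp o x) (SAlg.interp o y) (SAlg.interp o z) (SAlg.interp o w)
  eq_iff : ∀ {a b c d}, T a b c d → (a = b ↔ c = d)
  left_mem : ∀ {a b c d}, T a b c d → (a, b) ∈ μ
  right_mem : ∀ {a b c d}, T a b c d → (c, d) ∈ ν
  left_total : ∀ a, ∃ c, T a a c c
  right_total : ∀ c, ∃ a, T a a c c
  nontrivial : ∃ a b c d, T a b c d ∧ a ≠ b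

variable {μ : Set (A × A)} {ν : Set (B × B)} {T : A → A → B → B → Prop}

theorem IsLink.symm (h : IsLink S μ ν T) : IsLink S ν μ fun c d a b => T a b c d where
  compat o x y z w := h.compat o z w x y
  eq_iff h' := (h.eq_iff h').symm
  left_mem h' := h.right_mem h'
  right_mem h' := h.left_mem h'
  left_total := h.right_total
  right_total := h.left_total
  nontrivial := by
    obtain ⟨a, b, c, d, h', hne⟩ := h.nontrivial
    exact ⟨c, d, a, b, h', fun hcd => hne ((h.eq_iff h').2 hcd)⟩

theorem IsLink.swap (h : IsLink S μ ν T) (hμ : IsCongruence S μ) (hν : IsCongruence S ν) :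
    IsLink S μ ν fun a b c d => T b a d c where
  compat o x y z w := h.compat o y x w z
  eq_iff h' := by rw [eq_comm, h.eq_iff h', eq_comm]
  left_mem h' := hμ.2.symm (h.left_mem h')
  right_mem h' := hν.2.symm (h.right_mem h')
  left_total := h.left_total
  right_total := h.right_total
  nontrivial := by
    obtain ⟨a, b, c, d, h', hne⟩ := h.nontrivial
    exact ⟨b, a, d, c, h', hne.symm⟩

/-- Polynomials of `B` lift to polynomials of `A` along a link. -/
theorem IsLink.lift (h : IsLink S μ ν T) {g : (X → B) → B} (hg : IsPoly S g) :
    ∃ g' : (X → A) → A, IsPoly S g' ∧ ∀ x y z w, (∀ i, T (x i) (y i) (z i) (w i)) →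
      T (g' x) (g' y) (g z) (g w) := by
  induction hg with
  | proj i => exact ⟨fun x => x i, .proj i, fun _ _ _ _ h' => h' i⟩
  | const b =>
    obtain ⟨a, ha⟩ := h.right_total b
    exact ⟨fun _ => a, .const a, fun _ _ _ _ _ => ha⟩
  | app o f _ ih =>
    choose f' hf' hT using ih
    exact ⟨_, .app o f' hf', fun x y z w h' => h.compat o _ _ _ _ fun i => hT i x y z w h'⟩

theorem IsLink.lift1 (h : IsLink S μ ν T) {g : B → B} (hg : Poly1 S g) :
    ∃ g' : A → A, Poly1 S g' ∧ ∀ {x y z w}, T x y z w → T (g' x) (g' y) (g z) (g w) := by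
  obtain ⟨g', hg', hT⟩ := h.lift hg
  exact ⟨fun x => g' fun _ => x, hg'.comp fun _ => .proj (), fun {x y z w} h' =>
    hT (fun _ => x) (fun _ => y) (fun _ => z) (fun _ => w) fun _ => h'⟩

theorem IsLink.lift2 (h : IsLink S μ ν T) {g : B → B → B} (hg : Poly2 S g) :
    ∃ g' : A → A → A, Poly2 S g' ∧ ∀ {x y z w x' y' z' w'}, T x y z w → T x' y' z' w' →
      T (g' x x') (g' y y') (g z z') (g w w') := by
  obtain ⟨g', hg', hT⟩ := h.lift hg
  refine ⟨fun x y => g' fun i => cond i y x, hg'.comp fun i => ?_,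
    fun {x y z w x' y' z' w'} h1 h2 =>
      hT (fun i => cond i x' x) (fun i => cond i y' y) (fun i => cond i z' z)
        (fun i => cond i w' w) fun i => ?_⟩
  · cases i
    exacts [.proj false, .proj true]
  · cases i <;> assumption

theorem IsLink.lift3 (h : IsLink S μ ν T) {g : B → B → B → B} (hg : Poly3 S g) :
    ∃ g' : A → A → A → A, Poly3 S g' ∧
      ∀ {x y z w x' y' z' w' x'' y'' z'' w''}, T x y z w → T x' y' z' w' →
        T x'' y'' z'' w'' → T (g' x x' x'') (g' y y' y'') (g z z' z'') (g w w' w'') := by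
  obtain ⟨g', hg', hT⟩ := h.lift hg
  refine ⟨fun x y z => g' ![x, y, z], hg'.comp fun i => ?_,
    fun {x y z w x' y' z' w' x'' y'' z'' w''} h1 h2 h3 =>
      hT ![x, x', x''] ![y, y', y''] ![z, z', z''] ![w, w', w''] fun i => ?_⟩
  · fin_cases i
    exacts [.proj 0, .proj 1, .proj 2]
  · fin_cases i <;> assumption

theorem IsLink.false_of_mem [Finite A] (h : IsLink S μ ν T) (hμ : IsMonolith S μ)
    (hTay : IsTaylorAlg S A) (hC : Centralizes S μ μ (diag A)) {o i : B} (hoi : o ≠ i)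
    {s : B → B → B} (hs : Poly2 S s) (hoo : s o o = o) (hoi' : s o i = o) (hio : s i o = o)
    (hii : s i i = i) {a₁ a₂ : A} (ha : T a₁ a₂ o i) {b : B} (hb : b = o ∨ b = i)
    (h₁ : T a₁ a₁ b b) (h₂ : T a₂ a₂ b b) : False := by
  rcases hb with rfl | rfl
  · obtain ⟨s', -, hT⟩ := h.lift2 hs
    have e1 : s' a₁ a₁ = s' a₂ a₁ := (h.eq_iff (hT ha h₁)).2 (hoo.trans hio.symm)
    have e2 : s' a₂ a₁ = s' a₂ a₂ := (h.eq_iff (hT h₂ ha)).2 (hoo.trans hoi'.symm)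
    have e3 := (h.eq_iff (hT ha ha)).1 (e1.trans e2)
    rw [hoo, hii] at e3
    exact hoi e3
  · have hne : a₁ ≠ a₂ := fun h' => hoi ((h.eq_iff ha).1 h')
    obtain ⟨P, hP, P1, P2, P3⟩ := hμ.exists_maltsev_pair hTay hC hne (h.left_mem ha)
    obtain ⟨Q, hQ, hTQ⟩ := h.symm.lift3 hP
    have Q1 : Q o o b = Q b b b := (h.eq_iff (hTQ ha ha h₂)).1 P1
    have Q2 : Q b o o = Q b b b := by
      have := (h.eq_iff (hTQ h₂ ha ha)).1 (P2)
      exact this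
    have Q3 : Q o o o ≠ Q b b b := fun h' => P3 ((h.eq_iff (hTQ ha ha ha)).2 h')
    have hJ : Poly2 S fun x y => Q x (s x y) y := hQ.comp (.proj false) hs (.proj true)
    obtain ⟨J, -, hTJ⟩ := h.lift2 hJ
    have e1 : J a₁ a₁ = J a₂ a₁ := (h.eq_iff (hTJ ha h₁)).2 (by simp only [hoi', hii, Q1])
    have e2 : J a₂ a₁ = J a₂ a₂ := (h.eq_iff (hTJ h₂ ha)).2 (by simp only [hio, hii, Q2])
    have e3 := (h.eq_iff (hTJ ha ha)).1 (e1.trans e2)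
    simp only [hoo, hii] at e3
    exact Q3 e3

theorem IsLink.false_of_meet [Finite A] (h : IsLink S μ ν T) (hμ : IsMonolith S μ)
    (hν : IsMonolith S ν) (hTay : IsTaylorAlg S A) (hC : Centralizes S μ μ (diag A)) {o i : B}
    (hoi : o ≠ i) (hmem : (o, i) ∈ ν) {r : B → B} {s : B → B → B} (hr : Poly1 S r)
    (hs : Poly2 S s) (hro : r o = o) (hri : r i = i)
    (hrange : ∀ z, (o, z) ∈ ν → r z = o ∨ r z = i) (hoo : s o o = o) (hoi' : s o i = o)
    (hio : s i o = o) (hii : s i i = i) {a₁ a₂ : A} (ha : T a₁ a₂ o i) : False := by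
  have hne : a₁ ≠ a₂ := fun h' => hoi ((h.eq_iff ha).1 h')
  obtain ⟨s', hs', hTs⟩ := h.lift2 hs
  by_cases hfun : ∀ a c c', T a a c c → T a a c' c' → c = c'
  swap
  · push Not at hfun
    obtain ⟨a, c, c', hc, hc', hcc⟩ := hfun
    have hE := hν.eqvGen (R := fun c c' => ∃ a, T a a c c ∧ T a a c' c') (by
      rintro q hq c c' ⟨a, h1, h2⟩
      obtain ⟨q', -, hTq⟩ := h.lift1 hq
      exact ⟨q' a, hTq h1, hTq h2⟩) hcc ⟨a, hc, hc'⟩ hmem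
    have := (iff_of_eqvGen (f := fun c => s o c = s i c) ?_ hE).1 (hoo.trans hio.symm)
    · simp only [hoi', hii] at this
      exact hoi this
    · rintro c c' ⟨a, h1, h2⟩
      exact (h.eq_iff (hTs ha h1)).symm.trans (h.eq_iff (hTs ha h2))
  by_cases hinj : ∀ a a' c, T a a c c → T a' a' c c → a = a'
  · have hlift : ∀ c c', Relation.EqvGen
        (fun c c' => ∃ a a', T a a c c ∧ T a' a' c' c' ∧ (a, a') ∈ μ) c c' →
        ∀ a a', T a a c c → T a' a' c' c' → (a, a') ∈ μ := by
      intro c c' hE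
      induction hE with
      | rel c c' hcc =>
        obtain ⟨x, y, hx, hy, hxy⟩ := hcc
        intro a a' h1 h2
        rwa [hinj a x c h1 hx, hinj a' y c' h2 hy]
      | refl c =>
        intro a a' h1 h2
        rw [hinj a a' c h1 h2]
        exact hμ.1.2.refl _
      | symm c c' _ ih => exact fun a a' h1 h2 => hμ.1.2.symm (ih a' a h2 h1)
      | trans c c' c'' _ _ ih ih' =>
        intro a a' h1 h2
        obtain ⟨x, hx⟩ := h.right_total c'
        exact hμ.1.2.trans (ih a x h1 hx) (ih' x a' hx h2)
    obtain ⟨c₁, hc₁⟩ := h.left_total a₁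
    obtain ⟨c₂, hc₂⟩ := h.left_total a₂
    have hc₁₂ : c₁ ≠ c₂ := by
      rintro rfl
      exact hne (hinj _ _ _ hc₁ hc₂)
    have hE := hν.eqvGen
      (R := fun c c' => ∃ a a', T a a c c ∧ T a' a' c' c' ∧ (a, a') ∈ μ) (by
        rintro q hq c c' ⟨a, a', h1, h2, h3⟩
        obtain ⟨q', hq', hTq⟩ := h.lift1 hq
        exact ⟨q' a, q' a', hTq h1, hTq h2, hq'.mem hμ.1 h3⟩)
      hc₁₂ ⟨a₁, a₂, hc₁, hc₂, h.left_mem ha⟩ hmem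
    obtain ⟨x, hx⟩ := h.right_total o
    obtain ⟨y, hy⟩ := h.right_total i
    have hxy := hlift _ _ hE x y hx hy
    have e1 : s' x x = s' x y := hinj _ _ o (by simpa only [hoo] using hTs hx hx)
      (by simpa only [hoi'] using hTs hx hy)
    have e2 : s' y x = s' y y := hC.poly2 hμ.1.2.refl hs' hxy hxy e1
    have e3 := hTs hy hx
    have e4 := hTs hy hy
    rw [e2, hio] at e3
    rw [hii] at e4
    exact hoi (hfun _ _ _ e3 e4)
  · push Not at hinj
    obtain ⟨x, y, c, hx, hy, hxy⟩ := hinj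
    have hE := hμ.eqvGen (R := fun x y => ∃ c, T x x c c ∧ T y y c c) (by
      rintro q hq x y ⟨c, h1, h2⟩
      obtain ⟨q', -, hTq⟩ := h.symm.lift1 hq
      exact ⟨q' c, hTq h1, hTq h2⟩) hxy ⟨c, hx, hy⟩ (h.left_mem ha)
    obtain ⟨b, hb₁⟩ := h.left_total a₁
    have hb₂ : T a₂ a₂ b b := by
      refine (iff_of_eqvGen (f := fun a => T a a b b) ?_ hE).1 hb₁
      rintro x y ⟨c, h1, h2⟩
      constructor
      · intro h3
        rwa [hfun x b c h3 h1]
      · intro h3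
        rwa [hfun y b c h3 h2]
    obtain ⟨z, hz⟩ := h.right_total o
    obtain ⟨w, hw⟩ := h.right_total i
    have hsbo : s b o = o := by
      have e1 : s' a₁ z = s' a₂ z := (h.eq_iff (hTs ha hz)).2 (hoo.trans hio.symm)
      have e2 := hTs ha hz
      rw [← e1, hoo, hio] at e2
      exact hfun _ _ _ (hTs hb₁ hz) e2
    have hsbi : (o, s b i) ∈ ν := by
      have := hs.mem hν.1 (hν.1.2.refl b) hmem
      rwa [hsbo] at this
    obtain ⟨g, -, hTg⟩ := h.lift2 (g := fun x y => r (s x y))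
      (hr.comp (hs.comp (.proj false) (.proj true)))
    refine h.false_of_mem hμ hTay hC hoi hs hoo hoi' hio hii (a₁ := g a₁ w) (a₂ := g a₂ w)
      ?_ (hrange _ hsbi) (hTg hb₁ hw) (hTg hb₂ hw)
    simpa only [hoi', hii, hro, hri] using hTg ha hw

theorem IsLink.centralizes [Finite A] [Finite B] (h : IsLink S μ ν T) (hμ : IsMonolith S μ)
    (hν : IsMonolith S ν) (hA : IsTaylorAlg S A) (hB : IsTaylorAlg S B)
    (hC : Centralizes S μ μ (diag A)) : Centralizes S ν ν (diag B) := by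
  refine hν.centralizes_of_not_hasMeet hB ?_
  rintro ⟨o, i, r, s, hoi, hmem, hr, hs, hro, hri, hrange, hoo, hoi', hio, hii⟩
  obtain ⟨a₁, a₂, b₁, b₂, hT, hne⟩ := h.nontrivial
  have hb : b₁ ≠ b₂ := fun h' => hne ((h.eq_iff hT).2 h')
  obtain ⟨q, hq, hlink⟩ := hν.exists_link hb hmem (fun z => (o, z) ∈ ν ∧ r z = o)
    ⟨hν.1.2.refl o, hro⟩ fun h' => hoi (h'.2.symm.trans hri)
  obtain ⟨g, -, hTg⟩ := h.lift1 (g := fun x => r (q x)) (hr.comp hq)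
  have key : ∀ z w, (q z, q w) ∈ ν → ((o, q z) ∈ ν ∧ r (q z) = o) →
      ¬ ((o, q w) ∈ ν ∧ r (q w) = o) → r (q z) = o ∧ r (q w) = i := by
    intro z w hzw h1 h2
    have how := hν.1.2.trans h1.1 hzw
    exact ⟨h1.2, (hrange _ how).resolve_left fun h' => h2 ⟨how, h'⟩⟩
  have hqb : (q b₁, q b₂) ∈ ν := hq.mem hν.1 (h.right_mem hT)
  have hT' := hTg hT
  by_cases h1 : (o, q b₁) ∈ ν ∧ r (q b₁) = o
  · obtain ⟨e1, e2⟩ := key _ _ hqb h1 fun h2 => hlink (iff_of_true h1 h2)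
    rw [e1, e2] at hT'
    exact h.false_of_meet hμ hν hA hC hoi hmem hr hs hro hri hrange hoo hoi' hio hii hT'
  · obtain ⟨e1, e2⟩ := key _ _ (hν.1.2.symm hqb)
      (by by_contra h2; exact hlink (iff_of_false h1 h2)) h1
    rw [e1, e2] at hT'
    exact (h.swap hμ.1 hν.1).false_of_meet hμ hν hA hC hoi hmem hr hs hro hri hrange hoo hoi'
      hio hii hT'

end Links

section Quotients

variable {S : Signature} {A B : Type} [iA : SAlg S A] [iB : SAlg S B]

theorem IsCongruence.mk_eq_mk {ρ : Set (A × A)} (hρ : IsCongruence S ρ) {a b : A} :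
    ConQuot.mk ρ a = ConQuot.mk ρ b ↔ (a, b) ∈ ρ := by
  constructor
  · intro h
    exact (hρ.2.eqvGen_iff).1 (Quot.eqvGen_exact h)
  · exact fun h => Quot.sound h

theorem IsCongruence.interp_mk {ρ : Set (A × A)} (hρ : IsCongruence S ρ) (o : S.ops)
    (x : Fin (S.arity o) → A) :
    (quotAlg iA ρ).interp o (fun i => ConQuot.mk ρ (x i)) = ConQuot.mk ρ (SAlg.interp o x) := by
  refine hρ.mk_eq_mk.2 (hρ.1 o (fun i => (_, x i)) fun i => hρ.mk_eq_mk.1 ?_)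
  exact Classical.choose_spec (Quot.exists_rep (ConQuot.mk ρ (x i)))

theorem IsCongruence.eval_mk {ρ : Set (A × A)} (hρ : IsCongruence S ρ) {n : ℕ}
    (t : STerm S n) (x : Fin n → A) :
    letI := quotAlg iA ρ
    t.eval (fun i => ConQuot.mk ρ (x i)) = ConQuot.mk ρ (t.eval x) := by
  induction t with
  | var i => rfl
  | app o ts ih =>
    simp only [STerm.eval, ih]
    exact hρ.interp_mk o _

theorem ConQuot.mk_surjective (ρ : Set (A × A)) : Function.Surjective (ConQuot.mk ρ) :=
  Quot.exists_rep

theorem IsCongruence.taylorOn_quot {ρ : Set (A × A)} (hρ : IsCongruence S ρ) {n : ℕ}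
    {t : STerm S n} {u v : Fin n → Fin n → Fin 2} (h : TaylorOn S A t u v) :
    letI := quotAlg iA ρ
    TaylorOn S (ConQuot ρ) t u v := by
  let := quotAlg iA ρ
  refine ⟨fun a => ?_, fun i x y => ?_⟩
  · obtain ⟨a, rfl⟩ := ConQuot.mk_surjective ρ a
    rw [hρ.eval_mk t fun _ => a, h.1]
  · obtain ⟨x, rfl⟩ := ConQuot.mk_surjective ρ x
    obtain ⟨y, rfl⟩ := ConQuot.mk_surjective ρ y
    simp only [← apply_ite (ConQuot.mk ρ), hρ.eval_mk, h.2 i x y]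

/-- The image of a relation in the quotient by `ρ`. -/
def quotRel (ρ θ : Set (A × A)) : Set (ConQuot ρ × ConQuot ρ) :=
  Prod.map (ConQuot.mk ρ) (ConQuot.mk ρ) '' θ

theorem IsCongruence.mk_mem_quotRel {ρ θ : Set (A × A)} (hρ : IsCongruence S ρ)
    (hθ : IsCongruence S θ) (hle : ρ ⊆ θ) {a b : A} :
    (ConQuot.mk ρ a, ConQuot.mk ρ b) ∈ quotRel ρ θ ↔ (a, b) ∈ θ := by
  constructor
  · rintro ⟨⟨x, y⟩, hxy, h⟩
    obtain ⟨h1, h2⟩ := Prod.mk.inj h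
    exact hθ.2.trans (hθ.2.symm (hle (hρ.mk_eq_mk.1 h1)))
      (hθ.2.trans hxy (hle (hρ.mk_eq_mk.1 h2)))
  · exact fun h => ⟨(a, b), h, rfl⟩

theorem MeetIrredWith.isMonolith {ρ ρplus : Set (A × A)} (h : MeetIrredWith S ρ ρplus) :
    letI := quotAlg iA ρ
    IsMonolith S (quotRel ρ ρplus) := by
  let := quotAlg iA ρ
  obtain ⟨hρ, -, hp, hlt, hmin⟩ := h
  have hmem := fun a b => hρ.mk_mem_quotRel hp hlt.1 (a := a) (b := b)
  refine ⟨⟨?_, ?_, ?_, ?_⟩, ?_, ?_⟩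
  · intro o x hx
    choose y hy hyx using hx
    obtain rfl : (fun i => Prod.map (ConQuot.mk ρ) (ConQuot.mk ρ) (y i)) = x := funext hyx
    refine ⟨SAlg.interp o y, hp.1 o y hy, ?_⟩
    exact Prod.ext (hρ.interp_mk o _).symm (hρ.interp_mk o _).symm
  · intro a
    obtain ⟨a, rfl⟩ := ConQuot.mk_surjective ρ a
    exact (hmem a a).2 (hp.2.refl a)
  · intro a b hab
    obtain ⟨a, rfl⟩ := ConQuot.mk_surjective ρ a
    obtain ⟨b, rfl⟩ := ConQuot.mk_surjective ρ b
    exact (hmem b a).2 (hp.2.symm ((hmem a b).1 hab))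
  · intro a b c hab hbc
    obtain ⟨a, rfl⟩ := ConQuot.mk_surjective ρ a
    obtain ⟨b, rfl⟩ := ConQuot.mk_surjective ρ b
    obtain ⟨c, rfl⟩ := ConQuot.mk_surjective ρ c
    exact (hmem a c).2 (hp.2.trans ((hmem a b).1 hab) ((hmem b c).1 hbc))
  · intro heq
    refine hlt.2 ?_
    rintro ⟨a, b⟩ hab
    have := (hmem a b).2 hab
    rw [heq] at this
    exact hρ.mk_eq_mk.1 this
  · intro θ hθ hne
    let θ' : Set (A × A) := {p | (ConQuot.mk ρ p.1, ConQuot.mk ρ p.2) ∈ θ}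
    have hρθ : ρ ⊆ θ' := by
      rintro ⟨a, b⟩ hab
      change (ConQuot.mk ρ a, ConQuot.mk ρ b) ∈ θ
      rw [hρ.mk_eq_mk.2 hab]
      exact hθ.2.refl _
    have hsub : ρplus ⊆ θ' := by
      refine hmin θ' ⟨?_, fun a => hθ.2.refl _, fun h => hθ.2.symm h,
        fun h h' => hθ.2.trans h h'⟩ ⟨hρθ, fun hcon => hne ?_⟩
      · intro o x hx
        have := hθ.1 o (fun i => (ConQuot.mk ρ (x i).1, ConQuot.mk ρ (x i).2)) hx
        change (SAlg.interp o (fun i => ConQuot.mk ρ (x i).1),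
          SAlg.interp o fun i => ConQuot.mk ρ (x i).2) ∈ θ at this
        rwa [hρ.interp_mk, hρ.interp_mk] at this
      · ext ⟨a, b⟩
        obtain ⟨a, rfl⟩ := ConQuot.mk_surjective ρ a
        obtain ⟨b, rfl⟩ := ConQuot.mk_surjective ρ b
        constructor
        · exact fun hab => hρ.mk_eq_mk.2 (hcon hab)
        · intro hab
          exact hρθ (hρ.mk_eq_mk.1 hab)
    rintro _ ⟨⟨a, b⟩, hab, rfl⟩
    exact hsub hab

theorem MeetIrredWith.centralizes_iff {ρ ρplus : Set (A × A)} (h : MeetIrredWith S ρ ρplus) :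
    letI := quotAlg iA ρ
    Centralizes S (quotRel ρ ρplus) (quotRel ρ ρplus) (diag (ConQuot ρ)) ↔
      Centralizes S ρplus ρplus ρ := by
  let := quotAlg iA ρ
  obtain ⟨hρ, -, hp, hlt, hmin⟩ := h
  have hmem := fun a b => hρ.mk_mem_quotRel hp hlt.1 (a := a) (b := b)
  have heval : ∀ {n : ℕ} (t : STerm S (n + 1)) (a : A) (c : Fin n → A),
      t.eval (Fin.cons (ConQuot.mk ρ a) fun i => ConQuot.mk ρ (c i)) =
        ConQuot.mk ρ (t.eval (Fin.cons a c)) := by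
    intro n t a c
    rw [← hρ.eval_mk]
    congr 1
    funext i
    refine Fin.cases rfl (fun j => rfl) i
  constructor
  · intro hC n t a b c d hab hcd heq
    have := hC n t (ConQuot.mk ρ a) (ConQuot.mk ρ b) (fun i => ConQuot.mk ρ (c i))
      (fun i => ConQuot.mk ρ (d i)) ((hmem a b).2 hab) (fun i => (hmem _ _).2 (hcd i))
      (by rw [heval, heval]; exact hρ.mk_eq_mk.2 heq)
    rw [heval, heval] at this
    exact hρ.mk_eq_mk.1 this
  · intro hC n t a b c d hab hcd heq
    obtain ⟨a, rfl⟩ := ConQuot.mk_surjective ρ a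
    obtain ⟨b, rfl⟩ := ConQuot.mk_surjective ρ b
    choose c' hc' using fun i => ConQuot.mk_surjective ρ (c i)
    choose d' hd' using fun i => ConQuot.mk_surjective ρ (d i)
    obtain rfl : (fun i => ConQuot.mk ρ (c' i)) = c := funext hc'
    obtain rfl : (fun i => ConQuot.mk ρ (d' i)) = d := funext hd'
    rw [heval, heval] at heq ⊢
    exact hρ.mk_eq_mk.2 (hC n t a b c' d' ((hmem a b).1 hab) (fun i => (hmem _ _).1 (hcd i))
      (hρ.mk_eq_mk.1 heq))

/-- A good bridge induces a link between the quotient algebras. -/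
theorem GoodBridge.exists_isLink {ρ ρplus : Set (A × A)} {σ σplus : Set (B × B)}
    (hρ : MeetIrredWith S ρ ρplus) (hσ : MeetIrredWith S σ σplus) {T : Set (A × A × B × B)}
    (hT : GoodBridge S ρ ρplus σ σplus T) :
    letI := quotAlg iA ρ
    letI := quotAlg iB σ
    ∃ T', IsLink S (quotRel ρ ρplus) (quotRel σ σplus) T' := by
  let := quotAlg iA ρ
  let := quotAlg iB σ
  obtain ⟨-, τ, ⟨-, hτ⟩, τ', ⟨-, hτ'⟩, R, -, ⟨⟨hsub, -, -, hl, hr, hiff⟩, rfl, rfl⟩, -⟩ := hT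
  refine ⟨fun a b c d => ∃ p ∈ R, ConQuot.mk ρ p.1 = a ∧ ConQuot.mk ρ p.2.1 = b ∧
    ConQuot.mk σ p.2.2.1 = c ∧ ConQuot.mk σ p.2.2.2 = d, ?_, ?_, ?_, ?_, ?_, ?_, ?_⟩
  · intro o x y z w h
    choose p hp h1 h2 h3 h4 using h
    obtain rfl := funext h1
    obtain rfl := funext h2
    obtain rfl := funext h3
    obtain rfl := funext h4
    exact ⟨SAlg.interp o p, hsub o p hp, (hρ.1.interp_mk o _).symm, (hρ.1.interp_mk o _).symm,
      (hσ.1.interp_mk o _).symm, (hσ.1.interp_mk o _).symm⟩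
  · rintro _ _ _ _ ⟨⟨a, b, c, d⟩, hp, rfl, rfl, rfl, rfl⟩
    rw [hρ.1.mk_eq_mk, hσ.1.mk_eq_mk]
    exact hiff a b c d hp
  · rintro _ _ _ _ ⟨⟨a, b, c, d⟩, hp, rfl, rfl, rfl, rfl⟩
    exact ⟨(a, b), hτ ⟨c, d, hp⟩, rfl⟩
  · rintro _ _ _ _ ⟨⟨a, b, c, d⟩, hp, rfl, rfl, rfl, rfl⟩
    exact ⟨(c, d), hτ' ⟨a, b, hp⟩, rfl⟩
  · intro a
    obtain ⟨a, rfl⟩ := ConQuot.mk_surjective ρ a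
    obtain ⟨c, d, hp⟩ := hl.1 (hρ.1.2.refl a)
    exact ⟨ConQuot.mk σ c, _, hp, rfl, rfl, rfl,
      (hσ.1.mk_eq_mk.2 ((hiff _ _ _ _ hp).1 (hρ.1.2.refl a))).symm⟩
  · intro c
    obtain ⟨c, rfl⟩ := ConQuot.mk_surjective σ c
    obtain ⟨a, b, hp⟩ := hr.1 (hσ.1.2.refl c)
    exact ⟨ConQuot.mk ρ a, _, hp, rfl,
      (hρ.1.mk_eq_mk.2 ((hiff _ _ _ _ hp).2 (hσ.1.2.refl c))).symm, rfl, rfl⟩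
  · obtain ⟨⟨a, b⟩, ⟨c, d, hp⟩, hab⟩ := Set.exists_of_ssubset hl
    exact ⟨_, _, _, _, ⟨_, hp, rfl, rfl, rfl, rfl⟩, fun h => hab (hρ.1.mk_eq_mk.1 h)⟩

end Quotients

end Zhuk

/-- a good bridge between meet-irreducible congruences forces the
abelianness of `ρ⁺/ρ` and `σ⁺/σ` to agree. -/
theorem stmt_12 {S : Zhuk.Signature} {A B : Type} [Zhuk.SAlg S A] [Zhuk.SAlg S B]
    [Finite A] [Finite B]
    (hTay : Zhuk.CommonTaylor S A B)
    (ρ ρplus : Set (A × A)) (σ σplus : Set (B × B))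
    (hρ : Zhuk.MeetIrredWith S ρ ρplus) (hσ : Zhuk.MeetIrredWith S σ σplus)
    (T : Set (A × A × B × B)) (hT : Zhuk.GoodBridge S ρ ρplus σ σplus T) :
    Zhuk.Centralizes S ρplus ρplus ρ ↔ Zhuk.Centralizes S σplus σplus σ := by
  let iA : Zhuk.SAlg S (Zhuk.ConQuot ρ) := Zhuk.quotAlg ‹Zhuk.SAlg S A› ρ
  let iB : Zhuk.SAlg S (Zhuk.ConQuot σ) := Zhuk.quotAlg ‹Zhuk.SAlg S B› σ
  have : Finite (Zhuk.ConQuot ρ) := Finite.of_surjective _ (Zhuk.ConQuot.mk_surjective ρ)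
  have : Finite (Zhuk.ConQuot σ) := Finite.of_surjective _ (Zhuk.ConQuot.mk_surjective σ)
  obtain ⟨T', hT'⟩ := hT.exists_isLink hρ hσ
  obtain ⟨n, t, u, v, hn, huv, htA, htB⟩ := hTay
  have hA : Zhuk.IsTaylorAlg S (Zhuk.ConQuot ρ) :=
    ⟨n, t, u, v, hn, huv, hρ.1.taylorOn_quot htA⟩
  have hB : Zhuk.IsTaylorAlg S (Zhuk.ConQuot σ) :=
    ⟨n, t, u, v, hn, huv, hσ.1.taylorOn_quot htB⟩
  rw [← hρ.centralizes_iff, ← hσ.centralizes_iff]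
  exact ⟨hT'.centralizes hρ.isMonolith hσ.isMonolith hA hB,
    hT'.symm.centralizes hσ.isMonolith hρ.isMonolith hB hA⟩
end

section
/- Let A be a finite Taylor algebra and let ρ, σ ∈ Con(A) be meet-irreducible and adjacent, i.e., there exists a reflexive good bridge from (A,ρ) to (A,σ). If ρ ≠ σ, then Opt(σ) > σ. -/
namespace Zhuk

/-- Binary polynomial operations of an algebra. -/
inductive Pol2 (S : Signature) {A : Type} [SAlg S A] : (A → A → A) → Prop
  | fst : Pol2 S fun z _ => z
  | snd : Pol2 S fun _ w => w
  | const (c : A) : Pol2 S fun _ _ => c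
  | app (o : S.ops) (fs : Fin (S.arity o) → A → A → A) : (∀ i, Pol2 S (fs i)) →
      Pol2 S fun z w => SAlg.interp o fun i => fs i z w

section Polynomials

variable {S : Signature} {A : Type} [SAlg S A]

theorem Pol2.comp {f g h : A → A → A} (hf : Pol2 S f) (hg : Pol2 S g) (hh : Pol2 S h) :
    Pol2 S fun z w => f (g z w) (h z w) := by
  induction hf with
  | fst => exact hg
  | snd => exact hh
  | const c => exact Pol2.const c
  | app o fs _ ih => exact Pol2.app o _ ih

theorem Pol2.swap {f : A → A → A} (hf : Pol2 S f) : Pol2 S fun z w => f w z :=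
  hf.comp Pol2.snd Pol2.fst

theorem Pol2.iterate {f : A → A → A} (hf : Pol2 S f) (n : ℕ) :
    Pol2 S fun z w => (f z)^[n] w := by
  induction n with
  | zero => exact Pol2.snd
  | succ n ih =>
    simp only [Function.iterate_succ_apply']
    exact hf.comp Pol2.fst ih

theorem Pol2.mem {R : Set (A × A)} (hR : IsSubuniverse S R) (hrefl : ∀ a, (a, a) ∈ R)
    {h : A → A → A} (hh : Pol2 S h) {a b c d : A} (hab : (a, b) ∈ R) (hcd : (c, d) ∈ R) :
    (h a c, h b d) ∈ R := by
  induction hh with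
  | fst => exact hab
  | snd => exact hcd
  | const c => exact hrefl c
  | app o fs _ ih => exact hR o (fun i => (fs i a c, fs i b d)) ih

theorem Pol2.mem_quad {T : Set (A × A × A × A)} (hT : IsSubuniverse S T)
    (hrefl : ∀ a, (a, a, a, a) ∈ T) {h : A → A → A} (hh : Pol2 S h)
    {a b x y a' b' x' y' : A} (h1 : (a, b, x, y) ∈ T) (h2 : (a', b', x', y') ∈ T) :
    (h a a', h b b', h x x', h y y') ∈ T := by
  induction hh with
  | fst => exact h1
  | snd => exact h2
  | const c => exact hrefl c
  | app o fs _ ih =>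
    exact hT o (fun i => (fs i a a', fs i b b', fs i x x', fs i y y')) ih

theorem IsCongruence.pol2 {σ : Set (A × A)} (hσ : IsCongruence S σ) {h : A → A → A}
    (hh : Pol2 S h) {a b c d : A} (hab : (a, b) ∈ σ) (hcd : (c, d) ∈ σ) :
    (h a c, h b d) ∈ σ :=
  hh.mem hσ.1 hσ.2.refl hab hcd

/-- On a finite set, some positive number of iterations makes every self-map idempotent. -/
theorem exists_iterate_idempotent (A : Type) [Finite A] :
    ∃ n : ℕ, ∀ (φ : A → A) (w : A), φ^[n + 1] (φ^[n + 1] w) = φ^[n + 1] w := by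
  obtain ⟨i, j, hij, he⟩ := Finite.exists_ne_map_eq_of_infinite
    (fun (n : ℕ) (φ : A → A) => φ^[n])
  wlog hlt : i < j generalizing i j
  · exact this j i hij.symm he.symm (by omega)
  obtain ⟨d, rfl⟩ := Nat.exists_eq_add_of_lt hlt
  have step : ∀ (φ : A → A) (m k : ℕ), φ^[i + m + k * (d + 1)] = φ^[i + m] := by
    intro φ m k
    induction k with
    | zero => simp
    | succ k ih =>
      have h1 : i + m + (k + 1) * (d + 1) = (m + k * (d + 1)) + (i + d + 1) := by ring
      have h2 : i + m + k * (d + 1) = (m + k * (d + 1)) + i := by ring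
      have h3 : φ^[i] = φ^[i + d + 1] := congrFun he φ
      rw [h1, Function.iterate_add, ← h3, ← Function.iterate_add, ← h2, ih]
  refine ⟨i * (d + 1) + d, fun φ w => ?_⟩
  have hN : i * (d + 1) + d + 1 = i + (i * d + d + 1) := by ring
  have hN' : i * (d + 1) + d + 1 = (i + 1) * (d + 1) := by ring
  rw [← Function.iterate_add_apply]
  have := step φ (i * d + d + 1) (i + 1)
  rw [← hN, ← hN'] at this
  rw [this]

/-- Any binary polynomial `h` can be replaced by one that is idempotent in its second variable
and takes its values among the fixed points of its own specialisation at `v`, keeping the fixed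
points of `h v` and the pairs collapsed by any `h u` modulo `σ`. -/
theorem Pol2.exists_idempotent [Finite A] {σ : Set (A × A)} (hσ : IsCongruence S σ)
    {h : A → A → A} (hh : Pol2 S h) (v : A) :
    ∃ f : A → A → A, Pol2 S f ∧ (∀ z w, f z (f z w) = f z w) ∧
      (∀ z w, f v (f z w) = f z w) ∧ (∀ x, (h v x, x) ∈ σ → (f v x, x) ∈ σ) ∧
      ∀ u x y, (h u x, h u y) ∈ σ → (f u x, f u y) ∈ σ := by
  obtain ⟨n, hn⟩ := exists_iterate_idempotent A
  have hk : Pol2 S fun z w => (h v)^[n + 1] (h z w) :=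
    (hh.iterate (n + 1)).comp (Pol2.const v) hh
  have hiter : ∀ (φ : A → A), (∀ x y, (x, y) ∈ σ → (φ x, φ y) ∈ σ) → ∀ (m : ℕ) (x y : A),
      (x, y) ∈ σ → (φ^[m] x, φ^[m] y) ∈ σ := by
    intro φ hφ m
    induction m with
    | zero => exact fun x y hxy => hxy
    | succ m ih => exact fun x y hxy => ih _ _ (hφ _ _ hxy)
  have hv : (fun w => (h v)^[n + 1] (h v w))^[n + 1] = (h v)^[n + 1] := by
    have h1 : (fun w => (h v)^[n + 1] (h v w)) = (h v)^[n + 1 + 1] := rfl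
    have h2 : ∀ m, ((h v)^[n + 1])^[m + 1] = (h v)^[n + 1] := by
      intro m
      induction m with
      | zero => rfl
      | succ m ih =>
        rw [Function.iterate_succ, ih]
        exact funext fun w => hn _ w
    rw [h1, ← Function.iterate_mul, Nat.mul_comm, Function.iterate_mul, h2]
  refine ⟨_, hk.iterate (n + 1), fun z w => hn _ w, fun z w => ?_, fun x hx => ?_,
    fun u x y hxy => ?_⟩
  · simp only [hv]
    rw [Function.iterate_succ_apply' (fun w => (h v)^[n + 1] (h z w)) n w]
    exact hn _ _
  · simp only [hv]
    have : ∀ m, ((h v)^[m] x, x) ∈ σ := by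
      intro m
      induction m with
      | zero => exact hσ.2.refl x
      | succ m ih =>
        rw [Function.iterate_succ_apply']
        exact hσ.2.trans (hσ.pol2 hh (hσ.2.refl v) ih) hx
    exact this _
  · exact hiter (fun w => (h v)^[n + 1] (h u w))
      (fun a b hab => hσ.pol2 hk (hσ.2.refl u) hab) n _ _
      (hiter (h v) (fun a b hab => hσ.pol2 hh (hσ.2.refl v) hab) (n + 1) _ _ hxy)

/-- Every binary polynomial collapsing `(x, y)` modulo `σ` when specialised at `v` also does so
when specialised at `u`. -/
def CollapseLe (S : Signature) {A : Type} [SAlg S A] (σ : Set (A × A)) (x y u v : A) : Prop :=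
  ∀ h : A → A → A, Pol2 S h → (h v x, h v y) ∈ σ → (h u x, h u y) ∈ σ

theorem CollapseLe.of_map {σ : Set (A × A)} (hσ : IsCongruence S σ) {x y x' y' u v : A}
    {g : A → A} (hg : Pol2 S fun _ w => g w) (hx : (g x, x') ∈ σ) (hy : (g y, y') ∈ σ)
    (hle : CollapseLe S σ x y u v) : CollapseLe S σ x' y' u v := by
  intro h hh h1
  have hc : Pol2 S fun z w => h z (g w) := hh.comp Pol2.fst hg
  have e : ∀ z, (h z (g x), h z x') ∈ σ ∧ (h z (g y), h z y') ∈ σ := fun z =>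
    ⟨hσ.pol2 hh (hσ.2.refl z) hx, hσ.pol2 hh (hσ.2.refl z) hy⟩
  exact hσ.2.trans (hσ.2.symm (e u).1) (hσ.2.trans
    (hle _ hc (hσ.2.trans (e v).1 (hσ.2.trans h1 (hσ.2.symm (e v).2)))) (e u).2)

theorem CollapseLe.of_mem {σ : Set (A × A)} (hσ : IsCongruence S σ) (x y : A) {u v : A}
    (huv : (u, v) ∈ σ) : CollapseLe S σ x y u v := fun _ hh h1 =>
  hσ.2.trans (hσ.pol2 hh huv (hσ.2.refl x))
    (hσ.2.trans h1 (hσ.2.symm (hσ.pol2 hh huv (hσ.2.refl y))))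

/-- Elements that collapse `(x, y)` under the same binary polynomials form a congruence. -/
theorem isCongruence_collapse {σ : Set (A × A)} (x y : A) :
    IsCongruence S {p : A × A | CollapseLe S σ x y p.1 p.2 ∧ CollapseLe S σ x y p.2 p.1} := by
  refine ⟨fun o p hp => ?_, ⟨fun _ => ⟨fun _ _ h => h, fun _ _ h => h⟩, fun h => ⟨h.2, h.1⟩,
    fun h1 h2 => ⟨fun h hh h3 => h1.1 h hh (h2.1 h hh h3),
      fun h hh h3 => h2.2 h hh (h1.2 h hh h3)⟩⟩⟩
  have key : ∀ q r : Fin (S.arity o) → A, (∀ i, CollapseLe S σ x y (q i) (r i)) →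
      CollapseLe S σ x y (SAlg.interp o q) (SAlg.interp o r) := by
    intro q r hqr
    have hs : ∀ s : Finset (Fin (S.arity o)), CollapseLe S σ x y
        (SAlg.interp o fun i => if i ∈ s then q i else r i) (SAlg.interp o r) := by
      intro s
      induction s using Finset.induction_on with
      | empty => intro h hh h1; simpa using h1
      | insert j s hj ih =>
        intro h hh h1
        have hfs : Pol2 S fun z _ => SAlg.interp o fun i =>
            (if i = j then z else if i ∈ s then q i else r i : A) := by
          refine Pol2.app o (fun i z _ => if i = j then z else if i ∈ s then q i else r i)
            fun i => ?_
          by_cases hi : i = j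
          · simp only [hi, if_true]; exact Pol2.fst
          · simp only [hi, if_false]; exact Pol2.const _
        have h2 := hqr j _ (hh.comp hfs Pol2.snd)
        have e1 : (fun i => if i = j then r j else if i ∈ s then q i else r i) =
            fun i => if i ∈ s then q i else r i := by
          funext i
          by_cases hi : i = j
          · subst hi; simp [hj]
          · simp [hi]
        have e2 : (fun i => if i = j then q j else if i ∈ s then q i else r i) =
            fun i => if i ∈ insert j s then q i else r i := by
          funext i
          by_cases hi : i = j
          · subst hi; simp
          · simp [hi]
        simp only [e1, e2] at h2
        exact h2 (ih h hh h1)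
    simpa using hs Finset.univ
  exact ⟨key _ _ fun i => (hp i).1, key _ _ fun i => (hp i).2⟩

/-- Unary polynomials act transitively, modulo `σ`, on the nontrivial part of a minimal
saturated subuniverse. -/
theorem Cov.exists_pol {σ L : Set (A × A)} (hσ : IsCongruence S σ) (hL : L ∈ Cov S σ)
    {x y x' y' : A} (hxy : (x, y) ∈ L) (hn : (x, y) ∉ σ) (hxy' : (x', y') ∈ L) :
    ∃ g : A → A, (Pol2 S fun _ w => g w) ∧ (g x, x') ∈ σ ∧ (g y, y') ∈ σ := by
  obtain ⟨hsub, hsat, hlt, hmin⟩ := hL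
  let M : Set (A × A) := {p | ∃ g : A → A, (Pol2 S fun _ w => g w) ∧
    (g x, p.1) ∈ σ ∧ (g y, p.2) ∈ σ}
  have hM : M = L := by
    apply hmin
    · intro o p hp
      choose g hg h1 h2 using hp
      exact ⟨fun w => SAlg.interp o fun i => g i w, Pol2.app o (fun i _ w => g i w) hg,
        hσ.1 o (fun i => (g i x, (p i).1)) h1, hσ.1 o (fun i => (g i y, (p i).2)) h2⟩
    · ext ⟨p, q⟩
      constructor
      · rintro ⟨b, hb, c, ⟨g, hg, h1, h2⟩, hc⟩
        exact ⟨g, hg, hσ.2.trans h1 (hσ.2.symm hb), hσ.2.trans h2 hc⟩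
      · intro h
        exact ⟨p, hσ.2.refl p, q, h, hσ.2.refl q⟩
    · refine ⟨fun p hp => ⟨fun _ => p.1, Pol2.const _, hσ.2.refl _, hp⟩, fun h => hn ?_⟩
      exact h ⟨id, Pol2.snd, hσ.2.refl _, hσ.2.refl _⟩
    · rintro ⟨p, q⟩ ⟨g, hg, h1, h2⟩
      rw [← hsat]
      exact ⟨g x, hσ.2.symm h1, g y,
        hg.mem hsub (fun a => hlt.1 (hσ.2.refl a)) hxy hxy, h2⟩
  have : (x', y') ∈ M := hM ▸ hxy'
  exact this

/-- Failure of `CollapseLe` is witnessed by a polynomial fixing both entries of the pair. -/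
theorem Cov.exists_fixing {σ L : Set (A × A)} (hσ : IsCongruence S σ) (hL : L ∈ Cov S σ)
    {x y u v : A} (hxy : (x, y) ∈ L) (hle : ¬ CollapseLe S σ x y v u) :
    ∃ h : A → A → A, Pol2 S h ∧ (h v x, x) ∈ σ ∧ (h v y, y) ∈ σ ∧ (h u x, h u y) ∈ σ := by
  simp only [CollapseLe, not_forall] at hle
  obtain ⟨h, hh, hu, hv⟩ := hle
  have hmem : (h v x, h v y) ∈ L :=
    hh.mem hL.1 (fun a => hL.2.2.1.1 (hσ.2.refl a)) (hL.2.2.1.1 (hσ.2.refl v)) hxy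
  obtain ⟨g, hg, h1, h2⟩ := Cov.exists_pol hσ hL hmem hv hxy
  exact ⟨fun z w => g (h z w), hg.comp Pol2.fst hh, h1, h2, hσ.pol2 hg hu hu⟩

end Polynomials

section Separation

variable {S : Signature} {A : Type} [SAlg S A]

/-- A reflexive bridge whose left anchor lies inside `σ` and whose right anchor lies inside `L`,
such that `σ` is the full centralizer of `L` modulo `σ`. -/
structure SepBridge (S : Signature) {A : Type} [SAlg S A] (ρ σ L : Set (A × A))
    (T : Set (A × A × A × A)) : Prop where
  conρ : IsCongruence S ρ
  conσ : IsCongruence S σ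
  cov : L ∈ Cov S σ
  sub : IsSubuniverse S T
  refl : ∀ a, (a, a, a, a) ∈ T
  satl : ∀ {a₁ a₂ b₁ b₂ a₁' a₂'}, (a₁, a₂, b₁, b₂) ∈ T → (a₁, a₁') ∈ ρ → (a₂, a₂') ∈ ρ →
    (a₁', a₂', b₁, b₂) ∈ T
  satr : ∀ {a₁ a₂ b₁ b₂ b₁' b₂'}, (a₁, a₂, b₁, b₂) ∈ T → (b₁, b₁') ∈ σ → (b₂, b₂') ∈ σ →
    (a₁, a₂, b₁', b₂') ∈ T
  iff : ∀ {a₁ a₂ b₁ b₂}, (a₁, a₂, b₁, b₂) ∈ T → ((a₁, a₂) ∈ ρ ↔ (b₁, b₂) ∈ σ)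
  left : ∀ {a₁ a₂ b₁ b₂}, (a₁, a₂, b₁, b₂) ∈ T → (a₁, a₂) ∈ σ
  right : ∀ {a₁ a₂ b₁ b₂}, (a₁, a₂, b₁, b₂) ∈ T → (b₁, b₂) ∈ L
  sep : ∀ {x y u v}, (x, y) ∈ L → (x, y) ∉ σ → CollapseLe S σ x y u v →
    CollapseLe S σ x y v u → (u, v) ∈ σ

/-- The converse of a minimal saturated subuniverse is minimal saturated. -/
theorem Cov.rinv {σ L : Set (A × A)} (hσ : IsCongruence S σ) (hL : L ∈ Cov S σ) :
    rinv L ∈ Cov S σ := by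
  have hsub : ∀ M : Set (A × A), IsSubuniverse S M → IsSubuniverse S (Zhuk.rinv M) :=
    fun M hM o p hp => hM o (fun i => ((p i).2, (p i).1)) hp
  have hsat : ∀ M : Set (A × A), Saturated σ M → Saturated σ (Zhuk.rinv M) := by
    intro M hM
    ext ⟨p, q⟩
    constructor
    · rintro ⟨b, hb, c, hbc, hc⟩
      have : (q, p) ∈ M := by
        rw [← hM]
        exact ⟨c, hσ.2.symm hc, b, hbc, hσ.2.symm hb⟩
      exact this
    · intro h
      exact ⟨p, hσ.2.refl p, q, h, hσ.2.refl q⟩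
  have hlt : ∀ M : Set (A × A), σ ⊂ M → σ ⊂ Zhuk.rinv M := fun M hM =>
    ⟨fun p hp => hM.1 (hσ.2.symm hp), fun h => hM.2 fun p hp =>
      hσ.2.symm (h (show (p.2, p.1) ∈ Zhuk.rinv M from hp))⟩
  obtain ⟨h1, h2, h3, h4⟩ := hL
  refine ⟨hsub _ h1, hsat _ h2, hlt _ h3, fun M m1 m2 m3 m4 => ?_⟩
  have := h4 (Zhuk.rinv M) (hsub _ m1) (hsat _ m2) (hlt _ m3) fun p hp => m4 hp
  rw [← this]
  rfl

variable {ρ σ L : Set (A × A)} {T : Set (A × A × A × A)}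

theorem CollapseLe.swap (hσ : IsCongruence S σ) {x y u v : A}
    (h : CollapseLe S σ x y u v) : CollapseLe S σ y x u v :=
  fun f hf h1 => hσ.2.symm (h f hf (hσ.2.symm h1))

theorem SepBridge.swap (hT : SepBridge S ρ σ L T) :
    SepBridge S ρ σ (rinv L) {p | (p.2.1, p.1, p.2.2.2, p.2.2.1) ∈ T} where
  conρ := hT.conρ
  conσ := hT.conσ
  cov := Cov.rinv hT.conσ hT.cov
  sub := fun o p hp =>
    hT.sub o (fun i => ((p i).2.1, (p i).1, (p i).2.2.2, (p i).2.2.1)) hp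
  refl := hT.refl
  satl := fun h h1 h2 => hT.satl h h2 h1
  satr := fun h h1 h2 => hT.satr h h2 h1
  iff := fun h => ⟨fun h1 => hT.conσ.2.symm ((hT.iff h).1 (hT.conρ.2.symm h1)),
    fun h1 => hT.conρ.2.symm ((hT.iff h).2 (hT.conσ.2.symm h1))⟩
  left := fun h => hT.conσ.2.symm (hT.left h)
  right := fun h => hT.right h
  sep := fun h hn h1 h2 => hT.sep h (fun h3 => hn (hT.conσ.2.symm h3))
    (h1.swap hT.conσ) (h2.swap hT.conσ)

namespace SepBridge

theorem pol (hT : SepBridge S ρ σ L T) {h : A → A → A} (hh : Pol2 S h)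
    {a b x y a' b' x' y' : A} (h1 : (a, b, x, y) ∈ T) (h2 : (a', b', x', y') ∈ T) :
    (h a a', h b b', h x x', h y y') ∈ T :=
  hh.mem_quad hT.sub hT.refl h1 h2

theorem collapse_iff (hT : SepBridge S ρ σ L T) {h : A → A → A} (hh : Pol2 S h)
    {a b x y n m : A} (hp : (a, b, x, y) ∈ T) (hnm : (n, n, m, m) ∈ T) :
    (h n a, h n b) ∈ ρ ↔ (h m x, h m y) ∈ σ :=
  hT.iff (hT.pol hh hnm hp)

theorem trace (hT : SepBridge S ρ σ L T) {a b x y n m : A} (hp : (a, b, x, y) ∈ T)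
    (hn : (x, y) ∉ σ) (hnm : (n, n, m, m) ∈ T) : (n, m) ∈ σ :=
  hT.sep (hT.right hp) hn
    (fun _ hh h1 => (hT.collapse_iff hh hp (hT.refl n)).1 ((hT.collapse_iff hh hp hnm).2 h1))
    (fun _ hh h1 => (hT.collapse_iff hh hp hnm).1 ((hT.collapse_iff hh hp (hT.refl n)).2 h1))

theorem centralize (hT : SepBridge S ρ σ L T) {h : A → A → A} (hh : Pol2 S h)
    {a b x y c d : A} (hp : (a, b, x, y) ∈ T) (hcd : (c, d) ∈ σ)
    (h1 : (h c a, h c b) ∈ ρ) : (h d a, h d b) ∈ ρ :=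
  (hT.collapse_iff hh hp (hT.satr (hT.refl d) (hT.conσ.2.symm hcd) (hT.conσ.2.symm hcd))).2
    ((hT.collapse_iff hh hp (hT.refl c)).1 h1)

theorem not_fixing [Finite A] (hT : SepBridge S ρ σ L T) {a b x y u : A}
    (hp : (a, b, x, y) ∈ T) (hn : (x, y) ∉ σ) (hu : u = x ∨ u = y) :
    CollapseLe S σ x y a u := by
  by_contra hle
  have hσ := hT.conσ
  obtain ⟨h, hh, hx, hy, hc⟩ := Cov.exists_fixing hσ hT.cov (hT.right hp) hle
  obtain ⟨f, hf, idem, fix, f1, f2⟩ := hh.exists_idempotent hσ a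
  have key : ∀ w, (f a w, w) ∈ σ → (w, f u w) ∈ σ := by
    intro w hw
    set c := f a w with hcdef
    have hac : f a c = c := idem a w
    have hq := hT.pol hf hp (hT.refl c)
    rw [hac] at hq
    have h1 : (f b c, f b (f b c)) ∈ ρ := by rw [idem]; exact hT.conρ.2.refl _
    have h2 := hT.centralize hf hq (hσ.2.symm (hT.left hp)) h1
    rw [hac, fix] at h2
    have h3 := (hT.iff hq).1 h2
    have h4 : (c, c, f u c, f u c) ∈ T := by
      have h5 := hT.satl hq (hT.conρ.2.refl _) (hT.conρ.2.symm h2)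
      rcases hu with rfl | rfl
      · exact hT.satr h5 (hσ.2.refl _) (hσ.2.symm h3)
      · exact hT.satr h5 h3 (hσ.2.refl _)
    exact hσ.2.trans (hσ.2.symm hw) (hσ.2.trans (hT.trace hp hn h4)
      (hσ.pol2 hf (hσ.2.refl u) hw))
  exact hn (hσ.2.trans (key x (f1 x hx)) (hσ.2.trans (f2 u x y hc)
    (hσ.2.symm (key y (f1 y hy)))))

theorem wf [Finite A] (x y : A) :
    WellFounded fun u v => CollapseLe S σ x y u v ∧ ¬ CollapseLe S σ x y v u := by
  let r : A → A → Prop := fun u v => CollapseLe S σ x y u v ∧ ¬ CollapseLe S σ x y v u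
  have : IsTrans A r := ⟨fun a b c h1 h2 =>
    ⟨fun h hh h3 => h1.1 h hh (h2.1 h hh h3),
      fun h3 => h1.2 fun h hh h4 => h2.1 h hh (h3 h hh h4)⟩⟩
  have : Std.Irrefl r := ⟨fun a h => h.2 h.1⟩
  exact Finite.wellFounded_of_trans_of_irrefl r

theorem rebase (hT : SepBridge S ρ σ L T) {x y x' y' u v : A} (h : (x, y) ∈ L)
    (hn : (x, y) ∉ σ) (h' : (x', y') ∈ L) (hle : CollapseLe S σ x y u v) :
    CollapseLe S σ x' y' u v := by
  obtain ⟨g, hg, h1, h2⟩ := Cov.exists_pol hT.conσ hT.cov h hn h'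
  exact hle.of_map hT.conσ hg h1 h2

theorem left_not_mem_fst [Finite A] (hT : SepBridge S ρ σ L T) {a b x y : A}
    (hp : (a, b, x, y) ∈ T) (hn : (x, y) ∉ σ) : (a, x) ∉ σ := by
  obtain ⟨x₀, y₀, h0, hn0⟩ : ∃ x₀ y₀, (x₀, y₀) ∈ L ∧ (x₀, y₀) ∉ σ :=
    ⟨x, y, hT.right hp, hn⟩
  have hσ := hT.conσ
  induction x using (wf (S := S) (σ := σ) x₀ y₀).induction generalizing a b y with
  | _ x ih =>
  intro hax
  have hle : ¬ CollapseLe S σ x y y x := fun h => hn (hT.sep (hT.right hp) hn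
    (fun f hf h1 => CollapseLe.of_mem hσ x y (hσ.2.symm hax) f hf
      (hT.not_fixing hp hn (Or.inr rfl) f hf h1)) h)
  obtain ⟨h, hh, hx, hy, hc⟩ := Cov.exists_fixing hσ hT.cov (hT.right hp) hle
  have hq : (h a x, h b x, h x x, h y x) ∈ T := hT.pol hh hp (hT.refl x)
  have hbx : (x, b) ∈ σ := hσ.2.trans (hσ.2.symm hax) (hT.left hp)
  have hm : (h x x, x) ∉ σ := by
    intro hm
    have h1 := (hT.iff hq).2 (hσ.2.trans hm (hσ.2.symm hx))
    have h2 := hT.centralize hh.swap hp hbx h1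
    have h3 := (hT.collapse_iff hh hp (hT.refl x)).2 hc
    have h4 := hT.centralize hh hp (hσ.2.symm hax) h3
    have h5 := (hT.iff (hT.pol hh hp hp)).1 (hT.conρ.2.trans h4 h2)
    exact hn (hσ.2.trans (hσ.2.symm hm) (hσ.2.trans h5 hy))
  have hq' := hT.satr hq (hσ.2.refl _) hx
  have hmx : (h a x, h x x) ∈ σ := hσ.pol2 hh hax (hσ.2.refl x)
  have hle2 : CollapseLe S σ (h x x) x (h x x) x := fun f hf h1 =>
    CollapseLe.of_mem hσ _ _ (hσ.2.symm hmx) f hf (hT.not_fixing hq' hm (Or.inr rfl) f hf h1)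
  refine ih (h x x) ⟨hT.rebase (hT.right hq') hm h0 hle2, fun hge => hm ?_⟩ hq' hm hmx
  exact hT.sep (hT.right hq') hm hle2 (hT.rebase h0 hn0 (hT.right hq') hge)

theorem left_not_mem_snd [Finite A] (hT : SepBridge S ρ σ L T) {a b x y : A}
    (hp : (a, b, x, y) ∈ T) (hn : (x, y) ∉ σ) : (a, y) ∉ σ := fun h =>
  hT.swap.left_not_mem_fst (a := b) (b := a) (x := y) (y := x) hp
    (fun h1 => hn (hT.conσ.2.symm h1)) (hT.conσ.2.trans (hT.conσ.2.symm (hT.left hp)) h)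

theorem exists_left_aux [Finite A] (hT : SepBridge S ρ σ L T) {a b x y : A}
    (hp : (a, b, x, y) ∈ T) (hn : (x, y) ∉ σ) (hle : ¬ CollapseLe S σ x y x y) :
    ∃ a₁ b₁, (a₁, b₁, x, y) ∈ T ∧ ∃ a' b' c d, (a', b', c, d) ∈ T ∧ (c, d) ∉ σ ∧
      ((a₁, c) ∈ σ ∨ (a₁, d) ∈ σ) := by
  have hσ := hT.conσ
  obtain ⟨h, hh, hx, hy, hc⟩ := Cov.exists_fixing hσ hT.cov (hT.right hp) hle
  obtain ⟨f, hf, idem, -, f1, f2⟩ := hh.exists_idempotent hσ x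
  have h1 : (f x a, f x b, x, y) ∈ T :=
    hT.satr (hT.pol hf (hT.refl x) hp) (f1 x hx) (f1 y hy)
  refine ⟨f x a, f x b, h1, ?_⟩
  have hq := fun w => hT.pol hf h1 (hT.refl w)
  have hm : (f y x, f y y) ∈ σ := f2 y x y hc
  have htr : (f y (f x a), f y x) ∈ σ := by
    have h2 := hT.pol hf (hT.refl y) h1
    have h3 := (hT.iff h2).2 hm
    exact hT.trace hp hn (hT.satr (hT.satl h2 (hT.conρ.2.refl _) (hT.conρ.2.symm h3))
      (hσ.2.refl _) (hσ.2.symm hm))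
  by_cases hma : (f x a, f y x) ∈ σ
  · refine ⟨_, _, _, _, hq x, fun h2 => ?_, Or.inr hma⟩
    exact hT.left_not_mem_fst h1 hn
      (hσ.2.trans hma (hσ.2.trans (hσ.2.symm h2) (f1 x hx)))
  · refine ⟨_, _, _, _, hq (f x a), fun h2 => hma ?_, Or.inl ?_⟩
    · rw [idem] at h2
      exact hσ.2.trans h2 htr
    · rw [idem]
      exact hσ.2.refl _

theorem exists_left [Finite A] (hT : SepBridge S ρ σ L T) {a b x y : A}
    (hp : (a, b, x, y) ∈ T) (hn : (x, y) ∉ σ) :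
    ∃ a₁ b₁, (a₁, b₁, x, y) ∈ T ∧ ∃ a' b' c d, (a', b', c, d) ∈ T ∧ (c, d) ∉ σ ∧
      ((a₁, c) ∈ σ ∨ (a₁, d) ∈ σ) := by
  by_cases hle : CollapseLe S σ x y x y
  · have hle' : ¬ CollapseLe S σ x y y x := fun h => hn (hT.sep (hT.right hp) hn hle h)
    obtain ⟨a₁, b₁, h1, a', b', c, d, h2, h3, h4⟩ :=
      hT.swap.exists_left_aux (a := b) (b := a) (x := y) (y := x) hp
        (fun h1 => hn (hT.conσ.2.symm h1)) fun h => hle' (h.swap hT.conσ)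
    have h5 : (b₁, a₁) ∈ σ := hT.left h1
    exact ⟨b₁, a₁, h1, b', a', d, c, h2, fun h => h3 (hT.conσ.2.symm h),
      h4.symm.imp (hT.conσ.2.trans h5) (hT.conσ.2.trans h5)⟩
  · exact hT.exists_left_aux hp hn hle

/-- All tuples of a separating bridge are trivial. -/
theorem trivial [Finite A] (hT : SepBridge S ρ σ L T) {a b x y : A}
    (hp : (a, b, x, y) ∈ T) : (x, y) ∈ σ := by
  by_contra hn
  have hσ := hT.conσ
  let X : Set A := {u | ∃ a' b' c d, (a', b', c, d) ∈ T ∧ (c, d) ∉ σ ∧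
    ((u, c) ∈ σ ∨ (u, d) ∈ σ)}
  have hX : X.Nonempty := ⟨x, a, b, x, y, hp, hn, Or.inl (hσ.2.refl x)⟩
  obtain ⟨u, ⟨a', b', c, d, h1, h2, h3⟩, hmin⟩ :=
    (wf (S := S) (σ := σ) x y).has_min X hX
  obtain ⟨a₁, b₁, h4, h5⟩ := hT.exists_left h1 h2
  have hle : CollapseLe S σ c d a₁ u := by
    intro f hf h6
    rcases h3 with h3 | h3
    · exact hT.not_fixing h4 h2 (Or.inl rfl) f hf
        (CollapseLe.of_mem hσ _ _ (hσ.2.symm h3) f hf h6)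
    · exact hT.not_fixing h4 h2 (Or.inr rfl) f hf
        (CollapseLe.of_mem hσ _ _ (hσ.2.symm h3) f hf h6)
  have hge : CollapseLe S σ x y u a₁ := by
    by_contra hge
    exact hmin a₁ h5 ⟨hT.rebase (hT.right h1) h2 (hT.right hp) hle, hge⟩
  have hau := hT.sep (hT.right h1) h2 hle (hT.rebase (hT.right hp) hn (hT.right h1) hge)
  rcases h3 with h3 | h3
  · exact hT.left_not_mem_fst h4 h2 (hσ.2.trans hau h3)
  · exact hT.left_not_mem_snd h4 h2 (hσ.2.trans hau h3)

end SepBridge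

end Separation

section Optimal

variable {S : Signature} {A : Type} [SAlg S A] {σ σplus L L' : Set (A × A)}

/-- If `u` and `v` collapse a nontrivial pair of `L'` under the same polynomials, then the pair
lies in the maximal trace. -/
theorem IsOptOf.mem_of_collapse {γ : Set (A × A)} (hσ : IsCongruence S σ) (hL : L ∈ Cov S σ)
    (hγ : IsOptOf S σ L γ) {x y u v : A} (hxy : (x, y) ∈ L) (hn : (x, y) ∉ σ)
    (h1 : CollapseLe S σ x y u v) (h2 : CollapseLe S σ x y v u) : (u, v) ∈ γ := by
  have hr := hσ.2.refl
  let Q : Set (A × A × A × A) := {p | ∃ h : A → A → A, Pol2 S h ∧ (h u x, p.1) ∈ σ ∧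
    (h u y, p.2.1) ∈ σ ∧ (h v x, p.2.2.1) ∈ σ ∧ (h v y, p.2.2.2) ∈ σ}
  have hmem : ∀ {h : A → A → A} {z p q : A}, Pol2 S h → (h z x, p) ∈ σ → (h z y, q) ∈ σ →
      (p, q) ∈ L := by
    intro h z p q hh hp hq
    rw [← hL.2.1]
    exact ⟨_, hσ.2.symm hp, _, hh.mem hL.1 (fun a => hL.2.2.1.1 (hr a))
      (hL.2.2.1.1 (hr z)) hxy, hq⟩
  have hQl : pr12 Q = L := by
    ext ⟨p, q⟩
    constructor
    · rintro ⟨_, _, h, hh, hp, hq, -, -⟩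
      exact hmem hh hp hq
    · intro hpq
      obtain ⟨g, hg, hp, hq⟩ := Cov.exists_pol hσ hL hxy hn hpq
      exact ⟨p, q, fun _ w => g w, hg, hp, hq, hp, hq⟩
  have hQr : pr34 Q = L := by
    ext ⟨p, q⟩
    constructor
    · rintro ⟨_, _, h, hh, -, -, hp, hq⟩
      exact hmem hh hp hq
    · intro hpq
      obtain ⟨g, hg, hp, hq⟩ := Cov.exists_pol hσ hL hxy hn hpq
      exact ⟨p, q, fun _ w => g w, hg, hp, hq, hp, hq⟩
  have hQs : IsSubuniverse S Q := by
    intro o p hp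
    choose h hh e1 e2 e3 e4 using hp
    exact ⟨_, Pol2.app o h hh, hσ.1 o (fun i => (h i u x, (p i).1)) e1,
      hσ.1 o (fun i => (h i u y, (p i).2.1)) e2, hσ.1 o (fun i => (h i v x, (p i).2.2.1)) e3,
      hσ.1 o (fun i => (h i v y, (p i).2.2.2)) e4⟩
  have hQrefl : ∀ a, (a, a, a, a) ∈ Q := fun a =>
    ⟨fun _ _ => a, Pol2.const a, hr a, hr a, hr a, hr a⟩
  have huv : (u, u, v, v) ∈ Q := ⟨fun z _ => z, Pol2.fst, hr u, hr u, hr v, hr v⟩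
  obtain ⟨⟨T, ⟨⟨t1, t2, t3, -, -, t6⟩, tl, tr⟩, trefl, rfl⟩, hmax⟩ := hγ
  have hcl : pr12 (bComp T Q) = L := by
    apply Set.Subset.antisymm
    · rintro ⟨p, q⟩ ⟨c, d, b₁, b₂, hb, -⟩
      rw [← tl]
      exact ⟨b₁, b₂, hb⟩
    · rintro ⟨p, q⟩ hpq
      rw [← tl] at hpq
      obtain ⟨b₁, b₂, hb⟩ := hpq
      have hb' : (b₁, b₂) ∈ pr12 Q := by rw [hQl, ← tr]; exact ⟨p, q, hb⟩
      obtain ⟨c, d, hcd⟩ := hb'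
      exact ⟨c, d, b₁, b₂, hb, hcd⟩
  have hcr : pr34 (bComp T Q) = L := by
    apply Set.Subset.antisymm
    · rintro ⟨p, q⟩ ⟨c, d, b₁, b₂, -, hb⟩
      rw [← hQr]
      exact ⟨b₁, b₂, hb⟩
    · rintro ⟨p, q⟩ hpq
      rw [← hQr] at hpq
      obtain ⟨b₁, b₂, hb⟩ := hpq
      have hb' : (b₁, b₂) ∈ pr34 T := by rw [tr, ← hQl]; exact ⟨p, q, hb⟩
      obtain ⟨c, d, hcd⟩ := hb'
      exact ⟨c, d, b₁, b₂, hcd, hb⟩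
  have hmem' : btr (bComp T Q) ∈ refTr S σ L := by
    refine ⟨bComp T Q, ⟨⟨?_, ?_, ?_, ?_, ?_, ?_⟩, hcl, hcr⟩, ?_, rfl⟩
    · intro o p hp
      choose b₁ b₂ hb hb' using hp
      exact ⟨SAlg.interp o b₁, SAlg.interp o b₂,
        t1 o (fun i => ((p i).1, (p i).2.1, b₁ i, b₂ i)) hb,
        hQs o (fun i => (b₁ i, b₂ i, (p i).2.2.1, (p i).2.2.2)) hb'⟩
    · rintro a₁ a₂ c₁ c₂ a₁' a₂' ⟨b₁, b₂, hb, hb'⟩ h3 h4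
      exact ⟨b₁, b₂, t2 _ _ _ _ _ _ hb h3 h4, hb'⟩
    · rintro a₁ a₂ c₁ c₂ c₁' c₂' ⟨b₁, b₂, hb, h, hh, e1, e2, e3, e4⟩ h3 h4
      exact ⟨b₁, b₂, hb, h, hh, e1, e2, hσ.2.trans e3 h3, hσ.2.trans e4 h4⟩
    · rw [hcl]; exact hL.2.2.1
    · rw [hcr]; exact hL.2.2.1
    · rintro a₁ a₂ c₁ c₂ ⟨b₁, b₂, hb, h, hh, e1, e2, e3, e4⟩
      refine (t6 _ _ _ _ hb).trans ⟨fun h3 => ?_, fun h3 => ?_⟩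
      · exact hσ.2.trans (hσ.2.symm e3) (hσ.2.trans
          (h2 h hh (hσ.2.trans e1 (hσ.2.trans h3 (hσ.2.symm e2)))) e4)
      · exact hσ.2.trans (hσ.2.symm e1) (hσ.2.trans
          (h1 h hh (hσ.2.trans e3 (hσ.2.trans h3 (hσ.2.symm e4)))) e2)
    · exact fun a => ⟨a, a, trefl a, hQrefl a⟩
  have hsub : btr T ⊆ btr (bComp T Q) := fun p hp => ⟨p.2, p.2, hp, hQrefl p.2⟩
  rw [← hmax _ hmem' hsub]
  exact ⟨u, u, trefl u, huv⟩

/-- Nontrivial centralization passes from one minimal saturated subuniverse below the upper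
cover to any other. -/
theorem exists_collapse_of_covPlus [Finite A] (hσ : MeetIrredWith S σ σplus)
    (hL : L ∈ CovPlus S σ σplus) (hL' : L' ∈ CovPlus S σ σplus) {x y x' y' u v : A}
    (hxy : (x, y) ∈ L) (hxy' : (x', y') ∈ L') (hn' : (x', y') ∉ σ)
    (huv : (u, v) ∉ σ) (h1 : CollapseLe S σ x y u v) (h2 : CollapseLe S σ x y v u) :
    CollapseLe S σ x' y' x y ∧ CollapseLe S σ x' y' y x := by
  obtain ⟨hc, -, hpc, hlt, hmin⟩ := hσ
  have hsub := hmin {p | CollapseLe S σ x y p.1 p.2 ∧ CollapseLe S σ x y p.2 p.1}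
    (isCongruence_collapse x y)
    ⟨fun p hp => ⟨CollapseLe.of_mem hc _ _ hp, CollapseLe.of_mem hc _ _ (hc.2.symm hp)⟩,
      fun h => huv (h ⟨h1, h2⟩)⟩
  have main : ∀ r s, (r, s) ∈ σplus → (∀ z w, (z, w) ∈ σplus → ∀ f, Pol2 S f →
      (f r z, f s z) ∈ σ → (f r w, f s w) ∈ σ) → CollapseLe S σ x' y' s r := by
    intro r s hrs hcen
    by_contra hle
    obtain ⟨h, hh, hx, hy, hcol⟩ := Cov.exists_fixing hc hL'.1 hxy' hle
    obtain ⟨f, hf, idem, fix, f1, f2⟩ := hh.exists_idempotent hc s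
    have key : ∀ w, (f s w, w) ∈ σ → (f r w, w) ∈ σ := by
      intro w hw
      have hmw : (f r w, w) ∈ σplus :=
        hpc.2.trans (hpc.pol2 hf hrs (hpc.2.refl w)) (hlt.1 hw)
      refine hc.2.trans (hcen _ _ hmw f hf ?_) hw
      rw [idem, fix]
      exact hc.2.refl _
    exact hn' (hc.2.trans (hc.2.symm (key x' (f1 x' hx)))
      (hc.2.trans (f2 r x' y' hcol) (key y' (f1 y' hy))))
  have hxyp : (x, y) ∈ σplus := hL.2 hxy
  refine ⟨main y x (hpc.2.symm hxyp) fun z w hzw f hf h => ?_,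
    main x y hxyp fun z w hzw f hf h => ?_⟩
  · exact hc.2.symm ((hsub hzw).2 _ hf.swap (hc.2.symm h))
  · exact (hsub hzw).2 _ hf.swap h

end Optimal

end Zhuk

/-- if meet-irreducible `ρ ≠ σ` are adjacent (reflexive good bridge),
then `Opt(σ) > σ`. -/
theorem stmt_13 {S : Zhuk.Signature} {A : Type} [Zhuk.SAlg S A] [Finite A]
    (hTay : Zhuk.IsTaylorAlg S A)
    (ρ ρplus σ σplus : Set (A × A))
    (hρ : Zhuk.MeetIrredWith S ρ ρplus) (hσ : Zhuk.MeetIrredWith S σ σplus)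
    (T : Set (A × A × A × A)) (hT : Zhuk.GoodBridge S ρ ρplus σ σplus T)
    (href : Zhuk.ReflBridge T) (hne : ρ ≠ σ) :
    ∀ τ' ∈ Zhuk.CovPlus S σ σplus, ∀ γ : Set (A × A),
      Zhuk.IsOptOf S σ τ' γ → σ ⊂ γ := by
  intro τ'' hτ'' γ hγ
  obtain ⟨-, τ, hτ, τ', hτ', T', hsub, ⟨⟨t1, t2, t3, -, -, t6⟩, tl, tr⟩, htr⟩ := hT
  have hc := hσ.1
  have hcρ := hρ.1
  have hrefl : ∀ a, (a, a, a, a) ∈ T' := fun a => by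
    have h : (a, a) ∈ Zhuk.btr T' := htr ▸ href a
    exact h
  obtain ⟨⟨x, y⟩, hxy, hn⟩ := Set.exists_of_ssubset hτ'.1.2.2.1
  have hp : ∃ a b, (a, b, x, y) ∈ T' := by
    rw [← tr] at hxy
    exact hxy
  obtain ⟨a, b, hp⟩ := hp
  have hex : ∃ u v, (u, v) ∉ σ ∧ Zhuk.CollapseLe S σ x y u v ∧
      Zhuk.CollapseLe S σ x y v u := by
    by_contra hno
    have hsep : ∀ u v, Zhuk.CollapseLe S σ x y u v → Zhuk.CollapseLe S σ x y v u →
        (u, v) ∈ σ := fun u v h1 h2 => by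
      by_contra h3
      exact hno ⟨u, v, h3, h1, h2⟩
    have hle : ∀ u v, (u, v) ∈ ρ → Zhuk.CollapseLe S σ x y u v := by
      intro u v huv h hh h1
      have e : ∀ z, (h z a, h z b) ∈ ρ ↔ (h z x, h z y) ∈ σ := fun z =>
        t6 _ _ _ _ (hh.mem_quad t1 hrefl (hrefl z) hp)
      exact (e u).1 (Zhuk.CollapseLe.of_mem hcρ a b huv h hh ((e v).2 h1))
    have hρσ : ρ ⊂ σ := (show ρ ⊆ σ from fun p hp' =>
      hsep p.1 p.2 (hle _ _ hp') (hle _ _ (hcρ.2.symm hp'))).ssubset_of_ne hne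
    have hplus : ρplus ⊆ σ := hρ.2.2.2.2 σ hc hρσ
    have hS : Zhuk.SepBridge S ρ σ τ' T' :=
      { conρ := hcρ
        conσ := hc
        cov := hτ'.1
        sub := t1
        refl := hrefl
        satl := t2 _ _ _ _ _ _
        satr := t3 _ _ _ _ _ _
        iff := t6 _ _ _ _
        left := fun h => hplus (hτ.2 (tl ▸ ⟨_, _, h⟩))
        right := fun h => tr ▸ ⟨_, _, h⟩
        sep := fun h hn' h1 h2 => by
          obtain ⟨g, hg, e1, e2⟩ := Zhuk.Cov.exists_pol hc hτ'.1 h hn' hxy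
          exact hsep _ _ (h1.of_map hc hg e1 e2) (h2.of_map hc hg e1 e2) }
    exact hn (hS.trivial hp)
  obtain ⟨u, v, huv, h1, h2⟩ := hex
  obtain ⟨⟨x', y'⟩, hxy', hn'⟩ := Set.exists_of_ssubset hτ''.1.2.2.1
  obtain ⟨h3, h4⟩ := Zhuk.exists_collapse_of_covPlus hσ hτ' hτ'' hxy hxy' hn' huv h1 h2
  have hmem := hγ.mem_of_collapse hc hτ''.1 hxy' hn' h3 h4
  refine ⟨fun p hp' => ?_, fun h => hn (h hmem)⟩
  exact hγ.mem_of_collapse hc hτ''.1 hxy' hn' (Zhuk.CollapseLe.of_mem hc _ _ hp')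
    (Zhuk.CollapseLe.of_mem hc _ _ (hc.2.symm hp'))
end

section
/- Let A, B be finite algebras in a locally finite Taylor variety and let ρ ∈ Con(A), σ ∈ Con(B) be meet-irreducible. If A/ρ ≅ B/σ, then there exists a good bridge from (A,ρ) to (B,σ). -/
namespace Zhuk

theorem saturated_iff {A : Type} {ρ R : Set (A × A)}
    (hρ : Equivalence fun a b => (a, b) ∈ ρ) :
    Saturated ρ R ↔ ∀ a b a' b', (a, b) ∈ R → (a, a') ∈ ρ → (b, b') ∈ ρ → (a', b') ∈ R := by
  constructor
  · intro h a b a' b' hab ha hb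
    rw [← h]
    exact ⟨a, hρ.symm ha, b, hab, hb⟩
  · intro h
    ext ⟨a, b⟩
    constructor
    · rintro ⟨a', ha, b', hab, hb⟩
      exact h a' b' a b hab (hρ.symm ha) hb
    · intro hab
      exact ⟨a, hρ.refl a, b, hab, hρ.refl b⟩

theorem IsCongruence.saturated {S : Signature} {A : Type} [SAlg S A] {ρ θ : Set (A × A)}
    (hρ : Equivalence fun a b => (a, b) ∈ ρ) (hθ : IsCongruence S θ) (h : ρ ⊆ θ) :
    Saturated ρ θ :=
  (saturated_iff hρ).2 fun _ _ _ _ hab ha hb =>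
    hθ.2.trans (hθ.2.symm (h ha)) (hθ.2.trans hab (h hb))

/-- `E` is the lift to `A × B` of the graph of an isomorphism `A/ρ ≅ B/σ`. -/
structure IsIsoRel (S : Signature) {A B : Type} [SAlg S A] [SAlg S B]
    (ρ : Set (A × A)) (σ : Set (B × B)) (E : Set (A × B)) : Prop where
  sub : IsSubuniverse S E
  left_total : ∀ a, ∃ b, (a, b) ∈ E
  right_total : ∀ b, ∃ a, (a, b) ∈ E
  left_iff : ∀ {a a' b}, (a, b) ∈ E → ((a, a') ∈ ρ ↔ (a', b) ∈ E)
  right_iff : ∀ {a b b'}, (a, b) ∈ E → ((b, b') ∈ σ ↔ (a, b') ∈ E)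

/-- The image of a binary relation on `A` under `E ⊆ A × B`. -/
def transport {A B : Type} (E : Set (A × B)) (R : Set (A × A)) : Set (B × B) :=
  {q | ∃ a₁ a₂, (a₁, a₂) ∈ R ∧ (a₁, q.1) ∈ E ∧ (a₂, q.2) ∈ E}

theorem transport_mono {A B : Type} (E : Set (A × B)) {R R' : Set (A × A)} (h : R ⊆ R') :
    transport E R ⊆ transport E R' := by
  rintro _ ⟨a₁, a₂, ha, h₁, h₂⟩
  exact ⟨a₁, a₂, h ha, h₁, h₂⟩

theorem IsSubuniverse.transport {S : Signature} {A B : Type} [SAlg S A] [SAlg S B]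
    {E : Set (A × B)} {R : Set (A × A)} (hE : IsSubuniverse S E) (hR : IsSubuniverse S R) :
    IsSubuniverse S (transport E R) := by
  intro o x hx
  choose a₁ a₂ ha h₁ h₂ using hx
  exact ⟨_, _, hR o (fun i => (a₁ i, a₂ i)) ha, hE o (fun i => (a₁ i, (x i).1)) h₁,
    hE o (fun i => (a₂ i, (x i).2)) h₂⟩

namespace IsIsoRel

variable {S : Signature} {A B : Type} [SAlg S A] [SAlg S B]
  {ρ : Set (A × A)} {σ : Set (B × B)} {E : Set (A × B)}

theorem inv (h : IsIsoRel S ρ σ E) : IsIsoRel S σ ρ (rinv E) where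
  sub o x hx := h.sub o (fun i => ((x i).2, (x i).1)) hx
  left_total := h.right_total
  right_total := h.left_total
  left_iff hab := h.right_iff hab
  right_iff hab := h.left_iff hab

theorem mem_iff (h : IsIsoRel S ρ σ E) {a a' : A} {b b' : B} (hab : (a, b) ∈ E)
    (hab' : (a', b') ∈ E) : (a, a') ∈ ρ ↔ (b, b') ∈ σ := by
  constructor
  · intro ha
    exact (h.right_iff ((h.left_iff hab).1 ha)).2 hab'
  · intro hb
    exact (h.left_iff ((h.right_iff hab).1 hb)).2 hab'

theorem transport_base (h : IsIsoRel S ρ σ E) : transport E ρ = σ := by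
  ext ⟨b₁, b₂⟩
  constructor
  · rintro ⟨a₁, a₂, ha, h₁, h₂⟩
    exact (h.mem_iff h₁ h₂).1 ha
  · intro hb
    obtain ⟨a₁, h₁⟩ := h.right_total b₁
    obtain ⟨a₂, h₂⟩ := h.right_total b₂
    exact ⟨a₁, a₂, (h.mem_iff h₁ h₂).2 hb, h₁, h₂⟩

theorem transport_inv_transport (h : IsIsoRel S ρ σ E)
    (hρ : Equivalence fun a b => (a, b) ∈ ρ) {R : Set (A × A)} (hR : Saturated ρ R) :
    transport (rinv E) (transport E R) = R := by
  ext ⟨a₁, a₂⟩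
  constructor
  · rintro ⟨b₁, b₂, ⟨a₁', a₂', ha, h₁', h₂'⟩, h₁, h₂⟩
    exact (saturated_iff hρ).1 hR _ _ _ _ ha ((h.left_iff h₁').2 h₁) ((h.left_iff h₂').2 h₂)
  · intro ha
    obtain ⟨b₁, h₁⟩ := h.left_total a₁
    obtain ⟨b₂, h₂⟩ := h.left_total a₂
    exact ⟨b₁, b₂, ⟨a₁, a₂, ha, h₁, h₂⟩, h₁, h₂⟩

theorem transport_ssubset (h : IsIsoRel S ρ σ E) (hρ : Equivalence fun a b => (a, b) ∈ ρ)
    {R : Set (A × A)} (hR : Saturated ρ R) (hlt : ρ ⊂ R) : σ ⊂ transport E R := by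
  refine ⟨h.transport_base ▸ transport_mono E hlt.1, fun hle => hlt.2 ?_⟩
  rw [← h.transport_inv_transport hρ hR, ← h.inv.transport_base]
  exact transport_mono _ hle

theorem saturated_transport (h : IsIsoRel S ρ σ E) (hσ : Equivalence fun a b => (a, b) ∈ σ)
    (R : Set (A × A)) : Saturated σ (transport E R) := by
  rw [saturated_iff hσ]
  rintro b₁ b₂ b₁' b₂' ⟨a₁, a₂, ha, h₁, h₂⟩ hb₁ hb₂
  exact ⟨a₁, a₂, ha, (h.right_iff h₁).1 hb₁, (h.right_iff h₂).1 hb₂⟩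

theorem isCongruence_transport (h : IsIsoRel S ρ σ E) {θ : Set (A × A)}
    (hθ : IsCongruence S θ) (hle : ρ ⊆ θ) : IsCongruence S (transport E θ) := by
  refine ⟨h.sub.transport hθ.1, fun b => ?_, ?_, ?_⟩
  · obtain ⟨a, ha⟩ := h.right_total b
    exact ⟨a, a, hθ.2.refl a, ha, ha⟩
  · rintro b₁ b₂ ⟨a₁, a₂, ha, h₁, h₂⟩
    exact ⟨a₂, a₁, hθ.2.symm ha, h₂, h₁⟩
  · rintro b₁ b₂ b₃ ⟨a₁, a₂, ha, h₁, h₂⟩ ⟨a₂', a₃, ha', h₂', h₃⟩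
    exact ⟨a₁, a₃, hθ.2.trans ha (hθ.2.trans (hle ((h.left_iff h₂).2 h₂')) ha'), h₁, h₃⟩

theorem transport_mem_cov (h : IsIsoRel S ρ σ E) (hρ : Equivalence fun a b => (a, b) ∈ ρ)
    (hσ : Equivalence fun a b => (a, b) ∈ σ) {τ : Set (A × A)} (hτ : τ ∈ Cov S ρ) :
    transport E τ ∈ Cov S σ := by
  obtain ⟨hsub, hsat, hlt, hmin⟩ := hτ
  refine ⟨h.sub.transport hsub, h.saturated_transport hσ τ, h.transport_ssubset hρ hsat hlt,
    fun L hL hLsat hLlt hle => ?_⟩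
  have hback := hmin (transport (rinv E) L) (h.inv.sub.transport hL)
    (h.inv.saturated_transport hρ L) (h.inv.transport_ssubset hσ hLsat hLlt)
    ((transport_mono _ hle).trans (h.transport_inv_transport hρ hsat).subset)
  rw [← hback]
  exact (h.inv.transport_inv_transport hσ hLsat).symm

theorem transport_mem_covPlus (h : IsIsoRel S ρ σ E) {ρplus : Set (A × A)}
    {σplus : Set (B × B)} (hρ : MeetIrredWith S ρ ρplus) (hσ : MeetIrredWith S σ σplus)
    {τ : Set (A × A)} (hτ : τ ∈ CovPlus S ρ ρplus) : transport E τ ∈ CovPlus S σ σplus := by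
  obtain ⟨hρc, -, -, -, hρmin⟩ := hρ
  obtain ⟨hσc, -, hσp, hσlt, -⟩ := hσ
  refine ⟨h.transport_mem_cov hρc.2 hσc.2 hτ.1, ?_⟩
  have hsat := hσp.saturated hσc.2 hσlt.1
  have hle := hρmin _ (h.inv.isCongruence_transport hσp hσlt.1)
    (h.inv.transport_ssubset hσc.2 hsat hσlt)
  exact (transport_mono E (hτ.2.trans hle)).trans
    (h.inv.transport_inv_transport hσc.2 hsat).subset

theorem isBridgeLR (h : IsIsoRel S ρ σ E) (hρ : Equivalence fun a b => (a, b) ∈ ρ)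
    {τ : Set (A × A)} (hτ : τ ∈ Cov S ρ) :
    IsBridgeLR S ρ σ τ (transport E τ)
      {p | (p.1, p.2.1) ∈ τ ∧ (p.1, p.2.2.1) ∈ E ∧ (p.2.1, p.2.2.2) ∈ E} := by
  obtain ⟨hsub, hsat, hlt, -⟩ := hτ
  set T : Set (A × A × B × B) :=
    {p | (p.1, p.2.1) ∈ τ ∧ (p.1, p.2.2.1) ∈ E ∧ (p.2.1, p.2.2.2) ∈ E}
  have hl : pr12 T = τ := by
    ext ⟨a₁, a₂⟩
    constructor
    · rintro ⟨b₁, b₂, ha, -, -⟩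
      exact ha
    · intro ha
      obtain ⟨b₁, h₁⟩ := h.left_total a₁
      obtain ⟨b₂, h₂⟩ := h.left_total a₂
      exact ⟨b₁, b₂, ha, h₁, h₂⟩
  have hr : pr34 T = transport E τ := rfl
  refine ⟨⟨?_, ?_, ?_, hl.symm ▸ hlt, hr ▸ h.transport_ssubset hρ hsat hlt, ?_⟩, hl, hr⟩
  · intro o x hx
    exact ⟨hsub o (fun i => ((x i).1, (x i).2.1)) fun i => (hx i).1,
      h.sub o (fun i => ((x i).1, (x i).2.2.1)) fun i => (hx i).2.1,
      h.sub o (fun i => ((x i).2.1, (x i).2.2.2)) fun i => (hx i).2.2⟩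
  · rintro a₁ a₂ b₁ b₂ a₁' a₂' ⟨ha, h₁, h₂⟩ ha₁ ha₂
    exact ⟨(saturated_iff hρ).1 hsat _ _ _ _ ha ha₁ ha₂, (h.left_iff h₁).1 ha₁,
      (h.left_iff h₂).1 ha₂⟩
  · rintro a₁ a₂ b₁ b₂ b₁' b₂' ⟨ha, h₁, h₂⟩ hb₁ hb₂
    exact ⟨ha, (h.right_iff h₁).1 hb₁, (h.right_iff h₂).1 hb₂⟩
  · rintro a₁ a₂ b₁ b₂ ⟨-, h₁, h₂⟩
    exact h.mem_iff h₁ h₂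

end IsIsoRel

theorem MeetIrredWith.covPlus_nonempty {S : Signature} {A : Type} [SAlg S A] [Finite A]
    {ρ ρplus : Set (A × A)} (hρ : MeetIrredWith S ρ ρplus) : (CovPlus S ρ ρplus).Nonempty := by
  obtain ⟨hc, -, hp, hlt, -⟩ := hρ
  obtain ⟨τ, hle, hτ⟩ := (Set.toFinite
    {L : Set (A × A) | IsSubuniverse S L ∧ Saturated ρ L ∧ ρ ⊂ L}).exists_le_minimal
    ⟨hp.1, hp.saturated hc.2 hlt.1, hlt⟩
  exact ⟨τ, ⟨hτ.prop.1, hτ.prop.2.1, hτ.prop.2.2, fun L h₁ h₂ h₃ hL =>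
    hL.antisymm (hτ.le_of_le ⟨h₁, h₂, h₃⟩ hL)⟩, hle⟩

theorem ConQuot.mk_eq_iff {A : Type} {θ : Set (A × A)}
    (hθ : Equivalence fun a b => (a, b) ∈ θ) {a b : A} :
    ConQuot.mk θ a = ConQuot.mk θ b ↔ (a, b) ∈ θ := by
  unfold ConQuot.mk
  rw [Quot.eq, hθ.eqvGen_iff]

theorem quotAlg_interp_mk {S : Signature} {A : Type} [iA : SAlg S A] {θ : Set (A × A)}
    (hθ : IsCongruence S θ) (o : S.ops) (x : Fin (S.arity o) → A) :
    (quotAlg iA θ).interp o (fun i => ConQuot.mk θ (x i)) =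
      ConQuot.mk θ (SAlg.interp o x) :=
  (ConQuot.mk_eq_iff hθ.2).2 <|
    hθ.1 o (fun i => (Classical.choose (Quot.exists_rep (ConQuot.mk θ (x i))), x i)) fun i =>
      (ConQuot.mk_eq_iff hθ.2).1 (Classical.choose_spec (Quot.exists_rep (ConQuot.mk θ (x i))))

theorem exists_isIsoRel {S : Signature} {A B : Type} [iA : SAlg S A] [iB : SAlg S B]
    {ρ : Set (A × A)} {σ : Set (B × B)} (hρ : IsCongruence S ρ) (hσ : IsCongruence S σ)
    (hiso : IsoAlgI (quotAlg iA ρ) (quotAlg iB σ)) : ∃ E, IsIsoRel S ρ σ E := by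
  obtain ⟨f, hf⟩ := hiso
  refine ⟨{p | f (ConQuot.mk ρ p.1) = ConQuot.mk σ p.2}, ?_, fun a => ?_, fun b => ?_, ?_, ?_⟩
  · intro o x hx
    have h := hf o fun i => ConQuot.mk ρ (x i).1
    simp only [Set.mem_ofPred_eq] at hx
    simp only [hx] at h
    rw [quotAlg_interp_mk hρ, quotAlg_interp_mk hσ] at h
    exact h
  · obtain ⟨b, hb⟩ := Quot.exists_rep (f (ConQuot.mk ρ a))
    exact ⟨b, hb.symm⟩
  · obtain ⟨a, ha⟩ := Quot.exists_rep (f.symm (ConQuot.mk σ b))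
    exact ⟨a, f.eq_symm_apply.1 ha⟩
  · intro a a' b hab
    simp only [Set.mem_ofPred_eq] at hab ⊢
    rw [← ConQuot.mk_eq_iff hρ.2, ← hab, f.apply_eq_iff_eq, eq_comm]
  · intro a b b' hab
    simp only [Set.mem_ofPred_eq] at hab ⊢
    rw [← ConQuot.mk_eq_iff hσ.2, hab]

end Zhuk

/-- if `A/ρ ≅ B/σ` then there is a good bridge from `(A,ρ)` to `(B,σ)`. -/
theorem stmt_14 {S : Zhuk.Signature} {A B : Type} [iA : Zhuk.SAlg S A] [iB : Zhuk.SAlg S B]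
    [Finite A] [Finite B]
    (hTay : Zhuk.CommonTaylor S A B)
    (ρ ρplus : Set (A × A)) (σ σplus : Set (B × B))
    (hρ : Zhuk.MeetIrredWith S ρ ρplus) (hσ : Zhuk.MeetIrredWith S σ σplus)
    (hiso : Zhuk.IsoAlgI (Zhuk.quotAlg iA ρ) (Zhuk.quotAlg iB σ)) :
    ∃ T : Set (A × A × B × B), Zhuk.GoodBridge S ρ ρplus σ σplus T := by
  obtain ⟨E, hE⟩ := Zhuk.exists_isIsoRel hρ.1 hσ.1 hiso
  obtain ⟨τ, hτ⟩ := hρ.covPlus_nonempty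
  have hT := hE.isBridgeLR hρ.1.2 hτ.1
  exact ⟨_, hT.1, τ, hτ, _, hE.transport_mem_covPlus hρ hσ hτ, _, subset_rfl, hT, rfl⟩
end
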